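/- Let D be a connected C-homogeneous triangle-free digraph with infinitely many ends. Then for every vertex x of D the descendant digraph desc(x) is a tree, i.e. its underlying undirected graph is connected and contains no cycle. -/

import Mathlib

open Set

universe u

/-- The underlying undirected graph of a digraph given by its edge relation. -/
def UG {V : Type u} (E : V → V → Prop) : SimpleGraph V := SimpleGraph.fromRel E

/-- `E` is a digraph edge relation: irreflexive and antisymmetric. -/
def IsDigraph {V : Type u} (E : V → V → Prop) : Prop :=
  (∀ x, ¬ E x x) ∧ ∀ x y, E x y → ¬ E y x

/-- A ray in a graph: a one-way infinite path. -/
def IsRay {V : Type u} (G : SimpleGraph V) (r : ℕ → V) : Prop :=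
  Function.Injective r ∧ ∀ n, G.Adj (r n) (r (n + 1))

/-- A sequence is eventually in a set. -/
def EventuallyIn {V : Type u} (r : ℕ → V) (C : Set V) : Prop :=
  ∃ N, ∀ n, N ≤ n → r n ∈ C

/-- `C` is a connected component of the subgraph of `G` induced on `W`:
a maximal connected subset of `W`. -/
def IsCompOf {V : Type u} (G : SimpleGraph V) (C W : Set V) : Prop :=
  C.Nonempty ∧ C ⊆ W ∧ (G.induce C).Connected ∧
    ∀ C', C ⊆ C' → C' ⊆ W → (G.induce C').Connected → C' = C

/-- Two rays are equivalent if for every finite vertex set `S` they lie eventually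
in the same component of the graph minus `S`. -/
def RayEquiv {V : Type u} (G : SimpleGraph V) (r r' : ℕ → V) : Prop :=
  ∀ S : Finset V, ∃ C : Set V, IsCompOf G C {v | v ∉ S} ∧
    EventuallyIn r C ∧ EventuallyIn r' C

/-- The graph has more than one end: two inequivalent rays. -/
def MoreThanOneEnd {V : Type u} (G : SimpleGraph V) : Prop :=
  ∃ r r' : ℕ → V, IsRay G r ∧ IsRay G r' ∧ ¬ RayEquiv G r r'

/-- The graph has infinitely many ends: arbitrarily large families of pairwise
inequivalent rays. -/
def InfinitelyManyEnds {V : Type u} (G : SimpleGraph V) : Prop :=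
  ∀ n : ℕ, ∃ f : Fin n → (ℕ → V), (∀ i, IsRay G (f i)) ∧
    ∀ i j, i ≠ j → ¬ RayEquiv G (f i) (f j)

/-- A separation of a graph: a pair of vertex sets covering `V` such that every
edge lies within one side. -/
def IsSeparation {V : Type u} (G : SimpleGraph V) (c : Set V × Set V) : Prop :=
  c.1 ∪ c.2 = univ ∧ ∀ x y, G.Adj x y → (x ∈ c.1 ∧ y ∈ c.1) ∨ (x ∈ c.2 ∧ y ∈ c.2)

/-- The order of a separation: the number of vertices in its separator. -/
noncomputable def sepOrder {V : Type u} (c : Set V × Set V) : ℕ := (c.1 ∩ c.2).ncard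

/-- The neighbourhood of a vertex set. -/
def Nbhd {V : Type u} (G : SimpleGraph V) (A : Set V) : Set V :=
  {v | v ∉ A ∧ ∃ u ∈ A, G.Adj u v}

/-- The separation `(A, ∼)`. -/
def tildeSep {V : Type u} (G : SimpleGraph V) (A : Set V) : Set V × Set V :=
  (A, Aᶜ ∪ Nbhd G Aᶜ)

/-- `S` separates the wings of the separation `c`: every walk from one wing to
the other meets `S`. -/
def SeparatesWings {V : Type u} (G : SimpleGraph V) (c : Set V × Set V) (S : Set V) : Prop :=
  ∀ a ∈ c.1 \ c.2, ∀ b ∈ c.2 \ c.1, ∀ w : G.Walk a b, ∃ v ∈ w.support, v ∈ S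

/-- A separation of finite order with non-empty wings is essential if its first wing is
connected and no proper subset of the separator separates the wings. -/
def IsEssential {V : Type u} (G : SimpleGraph V) (c : Set V × Set V) : Prop :=
  IsSeparation G c ∧ (c.1 ∩ c.2).Finite ∧ (c.1 \ c.2).Nonempty ∧ (c.2 \ c.1).Nonempty ∧
  (G.induce (c.1 \ c.2)).Connected ∧
  ∀ S, S ⊂ c.1 ∩ c.2 → ¬ SeparatesWings G c S

/-- `C` is a wing of some separation in `𝒞`. -/
def IsWingOf {V : Type u} (𝒞 : Set (Set V × Set V)) (C : Set V) : Prop :=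
  ∃ d ∈ 𝒞, C = d.1 \ d.2 ∨ C = d.2 \ d.1

/-- A cut system. -/
def IsCutSystem {V : Type u} (G : SimpleGraph V) (𝒞 : Set (Set V × Set V)) : Prop :=
  𝒞.Nonempty ∧ (∀ c ∈ 𝒞, IsEssential G c) ∧
  (∀ c ∈ 𝒞, ∃ d ∈ 𝒞, d.1 ⊆ c.2) ∧
  (∀ c ∈ 𝒞, ∀ C : Set V, IsCompOf G C (c.2 \ c.1) →
    (∃ d ∈ 𝒞, d.1 \ d.2 ⊆ C) → tildeSep G (C ∪ Nbhd G C) ∈ 𝒞) ∧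
  (∀ c ∈ 𝒞, ∀ c' ∈ 𝒞, ∃ C₁ C₂ : Set V,
    ((IsCompOf G C₁ ((c.1 \ c.2) ∩ (c'.1 \ c'.2)) ∧
      IsCompOf G C₂ ((c.2 \ c.1) ∩ (c'.2 \ c'.1))) ∨
     (IsCompOf G C₁ ((c.2 \ c.1) ∩ (c'.1 \ c'.2)) ∧
      IsCompOf G C₂ ((c.1 \ c.2) ∩ (c'.2 \ c'.1)))) ∧
    IsWingOf 𝒞 C₁ ∧ IsWingOf 𝒞 C₂)

/-- Pick a side of a separation. -/
def pickSide {V : Type u} (c : Set V × Set V) : Bool → Set V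
  | false => c.1
  | true => c.2

/-- Two cuts are nested (with respect to the cut system `𝒞`). -/
def NestedPair {V : Type u} (G : SimpleGraph V) (𝒞 : Set (Set V × Set V))
    (c d : Set V × Set V) : Prop :=
  ∃ i j : Bool,
    ((¬ ∃ C, IsCompOf G C ((tildeSep G (pickSide c i ∩ pickSide d j)).1 \
        (tildeSep G (pickSide c i ∩ pickSide d j)).2) ∧
        tildeSep G (C ∪ Nbhd G C) ∈ 𝒞) ∨
     (¬ ∃ C, IsCompOf G C ((tildeSep G (pickSide c i ∩ pickSide d j)).2 \
        (tildeSep G (pickSide c i ∩ pickSide d j)).1) ∧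
        tildeSep G (C ∪ Nbhd G C) ∈ 𝒞)) ∧
    (c.1 ∩ c.2) ∪ (d.1 ∩ d.2) ⊆ pickSide c (!i) ∩ pickSide d (!j)

/-- A cut system is nested if each two of its cuts are nested. -/
def IsNestedSystem {V : Type u} (G : SimpleGraph V) (𝒞 : Set (Set V × Set V)) : Prop :=
  ∀ c ∈ 𝒞, ∀ d ∈ 𝒞, NestedPair G 𝒞 c d

/-- `S` is a `𝒞`-separator. -/
def IsSeparatorOf {V : Type u} (𝒞 : Set (Set V × Set V)) (S : Set V) : Prop :=
  ∃ c ∈ 𝒞, c.1 ∩ c.2 = S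

/-- A vertex set contains an end: some ray lies in it. -/
def ContainsEnd {V : Type u} (G : SimpleGraph V) (A : Set V) : Prop :=
  ∃ r : ℕ → V, IsRay G r ∧ ∀ n, r n ∈ A

/-- A basic cut system. -/
def IsBasic {V : Type u} (G : SimpleGraph V) (𝒞 : Set (Set V × Set V)) : Prop :=
  IsCutSystem G 𝒞 ∧
  (∀ c ∈ 𝒞, ∀ d ∈ 𝒞, ¬ sepOrder c < sepOrder d) ∧
  IsNestedSystem G 𝒞 ∧
  (∀ φ : G ≃g G, ∀ c ∈ 𝒞, ((⇑φ '' c.1, ⇑φ '' c.2) : Set V × Set V) ∈ 𝒞) ∧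
  (∀ S S' : Set V, IsSeparatorOf 𝒞 S → IsSeparatorOf 𝒞 S' → ∃ φ : G ≃g G, ⇑φ '' S = S') ∧
  (∀ c ∈ 𝒞, ContainsEnd G c.1 ∧ ContainsEnd G c.2 ∧
    ¬ ∃ d : Set V × Set V, IsSeparation G d ∧ (d.1 ∩ d.2).Finite ∧
      (d.1 ∩ d.2).ncard < sepOrder c ∧ ContainsEnd G d.1 ∧ ContainsEnd G d.2)

/-- The defining property of a `𝒞`-block. -/
def BlockProp {V : Type u} (𝒞 : Set (Set V × Set V)) (X : Set V) : Prop :=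
  (∀ c ∈ 𝒞, (X ⊆ c.1 ∨ X ⊆ c.2) ∧ ¬ (X ⊆ c.1 ∧ X ⊆ c.2)) ∧
  ∃ c ∈ 𝒞, X ⊆ c.1 ∧ c.1 ∩ c.2 ⊆ X

/-- A `𝒞`-block: a maximal vertex set with the block property. -/
def IsCBlock {V : Type u} (𝒞 : Set (Set V × Set V)) (X : Set V) : Prop :=
  BlockProp 𝒞 X ∧ ∀ X', X ⊆ X' → BlockProp 𝒞 X' → X' = X

/-- A digraph is C-homogeneous: every isomorphism between finite induced
subdigraphs with connected underlying graphs extends to an automorphism. -/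
def DigraphCHom {V : Type u} (E : V → V → Prop) : Prop :=
  ∀ (X Y : Set V), X.Finite → Y.Finite → ((UG E).induce X).Connected →
  ∀ φ : X ≃ Y, (∀ a b : X, E a.1 b.1 ↔ E (φ a).1 (φ b).1) →
  ∃ ψ : Equiv.Perm V, (∀ x y, E (ψ x) (ψ y) ↔ E x y) ∧ ∀ a : X, ψ a.1 = (φ a).1

/-- A graph is C-homogeneous: every isomorphism between finite connected induced
subgraphs extends to an automorphism. -/
def GraphCHom {V : Type u} (G : SimpleGraph V) : Prop :=
  ∀ (X Y : Set V), X.Finite → Y.Finite → (G.induce X).Connected →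
  ∀ φ : X ≃ Y, (∀ a b : X, G.Adj a.1 b.1 ↔ G.Adj (φ a).1 (φ b).1) →
  ∃ ψ : G ≃g G, ∀ a : X, ψ a.1 = (φ a).1

/-- The digraph contains a triangle: three pairwise adjacent vertices. -/
def HasTriangle {V : Type u} (E : V → V → Prop) : Prop :=
  ∃ x y z : V, (UG E).Adj x y ∧ (UG E).Adj y z ∧ (UG E).Adj x z

/-- An `n`-arc: a directed path `p 0, p 1, …, p n`. -/
def IsArc {V : Type u} (E : V → V → Prop) (n : ℕ) (p : ℕ → V) : Prop :=
  (∀ i j, i ≤ n → j ≤ n → p i = p j → i = j) ∧ ∀ i < n, E (p i) (p (i + 1))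

/-- A digraph is highly-arc-transitive: for every `n`, its automorphism group acts
transitively on `n`-arcs. -/
def HighlyArcTransitive {V : Type u} (E : V → V → Prop) : Prop :=
  ∀ n : ℕ, ∀ p q : ℕ → V, IsArc E n p → IsArc E n q →
  ∃ ψ : Equiv.Perm V, (∀ x y, E (ψ x) (ψ y) ↔ E x y) ∧ ∀ i ≤ n, ψ (p i) = q i

/-- An alternating walk `w 0, …, w n` in a digraph. -/
def IsAltWalk {V : Type u} (E : V → V → Prop) (n : ℕ) (w : ℕ → V) : Prop :=
  (∀ i < n, E (w i) (w (i + 1)) ∨ E (w (i + 1)) (w i)) ∧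
  ∀ i, i + 2 ≤ n → (E (w i) (w (i + 1)) ↔ E (w (i + 2)) (w (i + 1)))

/-- The edge `e` lies on the walk `w 0, …, w n` (in either direction). -/
def EdgeOnWalk {V : Type u} (n : ℕ) (w : ℕ → V) (e : V × V) : Prop :=
  ∃ i < n, (w i = e.1 ∧ w (i + 1) = e.2) ∨ (w i = e.2 ∧ w (i + 1) = e.1)

/-- Two edges are reachable from each other: they lie on a common alternating walk. -/
def Reach {V : Type u} (E : V → V → Prop) (e f : V × V) : Prop :=
  ∃ n w, IsAltWalk E n w ∧ EdgeOnWalk n w e ∧ EdgeOnWalk n w f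

/-- The edge relation of the reachability digraph `Δ_e`. -/
def DeltaRel {V : Type u} (E : V → V → Prop) (e : V × V) : V → V → Prop :=
  fun x y => E x y ∧ Reach E e (x, y)

/-- The underlying undirected graph of the reachability digraph `Δ_e`. -/
def DeltaGraph {V : Type u} (E : V → V → Prop) (e : V × V) : SimpleGraph V :=
  UG (DeltaRel E e)

/-- Tails of edges of `𝒜(e)`. -/
def Tails {V : Type u} (E : V → V → Prop) (e : V × V) : Set V :=
  {x | ∃ y, DeltaRel E e x y}

/-- Heads of edges of `𝒜(e)`. -/
def Heads {V : Type u} (E : V → V → Prop) (e : V × V) : Set V :=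
  {y | ∃ x, DeltaRel E e x y}

/-- The set of descendants of a vertex. -/
def Descendants {V : Type u} (E : V → V → Prop) (x : V) : Set V :=
  {y | ∃ n p, IsArc E n p ∧ p 0 = x ∧ p n = y}

/-- `(X, Y)` is a bipartition of the graph `G`. -/
def IsBipartition {V : Type u} (G : SimpleGraph V) (X Y : Set V) : Prop :=
  X ∪ Y = univ ∧ Disjoint X Y ∧
  ∀ a b, G.Adj a b → (a ∈ X ∧ b ∈ Y) ∨ (a ∈ Y ∧ b ∈ X)

/-- `G` with sides `X`, `Y` is C-homogeneous bipartite: every isomorphism between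
finite connected induced subgraphs preserving the sides extends to a side-preserving
automorphism. -/
def BipCHom {V : Type u} (G : SimpleGraph V) (X Y : Set V) : Prop :=
  ∀ (A B : Set V), A.Finite → B.Finite → (G.induce A).Connected →
  ∀ φ : A ≃ B, (∀ a b : A, G.Adj a.1 b.1 ↔ G.Adj (φ a).1 (φ b).1) →
  (∀ a : A, a.1 ∈ X ↔ (φ a).1 ∈ X) → (∀ a : A, a.1 ∈ Y ↔ (φ a).1 ∈ Y) →
  ∃ ψ : G ≃g G, (∀ v, v ∈ X ↔ ψ v ∈ X) ∧ (∀ v, v ∈ Y ↔ ψ v ∈ Y) ∧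
    ∀ a : A, ψ a.1 = (φ a).1

/-- `G` with sides `X`, `Y` is homogeneous bipartite: every isomorphism between
finite induced subgraphs preserving the sides extends to a side-preserving
automorphism. -/
def BipHom {V : Type u} (G : SimpleGraph V) (X Y : Set V) : Prop :=
  ∀ (A B : Set V), A.Finite → B.Finite →
  ∀ φ : A ≃ B, (∀ a b : A, G.Adj a.1 b.1 ↔ G.Adj (φ a).1 (φ b).1) →
  (∀ a : A, a.1 ∈ X ↔ (φ a).1 ∈ X) → (∀ a : A, a.1 ∈ Y ↔ (φ a).1 ∈ Y) →
  ∃ ψ : G ≃g G, (∀ v, v ∈ X ↔ ψ v ∈ X) ∧ (∀ v, v ∈ Y ↔ ψ v ∈ Y) ∧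
    ∀ a : A, ψ a.1 = (φ a).1

/-- `G` with sides `X`, `Y` is generic bipartite. -/
def GenericBip {V : Type u} (G : SimpleGraph V) (X Y : Set V) : Prop :=
  (∀ U W : Set V, U ⊆ X → W ⊆ X → U.Finite → W.Finite → Disjoint U W →
    ∃ v ∈ Y, (∀ u ∈ U, G.Adj v u) ∧ ∀ w ∈ W, ¬ G.Adj v w) ∧
  (∀ U W : Set V, U ⊆ Y → W ⊆ Y → U.Finite → W.Finite → Disjoint U W →
    ∃ v ∈ X, (∀ u ∈ U, G.Adj v u) ∧ ∀ w ∈ W, ¬ G.Adj v w)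

section VertexCuts

open scoped Classical

variable {V : Type u} {G : SimpleGraph V}

/-- `b` is reachable from `a` in the graph `G` minus `S`. -/
def Conn (G : SimpleGraph V) (S : Finset V) (a b : V) : Prop :=
  a ∉ S ∧ Relation.ReflTransGen (fun u v => G.Adj u v ∧ v ∉ S) a b

theorem Conn.refl {S : Finset V} {a : V} (h : a ∉ S) : Conn G S a a := ⟨h, .refl⟩

theorem Conn.induct {S : Finset V} {a b : V} (h : Conn G S a b) {P : V → Prop} (ha : P a)
    (hP : ∀ u v, P u → G.Adj u v → v ∉ S → P v) : P b := by
  obtain ⟨-, h⟩ := h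
  induction h with
  | refl => exact ha
  | tail _ h ih => exact hP _ _ ih h.1 h.2

theorem Conn.right_notMem {S : Finset V} {a b : V} (h : Conn G S a b) : b ∉ S :=
  h.induct (P := fun v => v ∉ S) h.1 fun _ _ _ _ hv => hv

theorem Conn.step {S : Finset V} {a b c : V} (h : Conn G S a b) (hbc : G.Adj b c)
    (hc : c ∉ S) : Conn G S a c := ⟨h.1, h.2.tail ⟨hbc, hc⟩⟩

theorem Conn.trans {S : Finset V} {a b c : V} (h : Conn G S a b) (h' : Conn G S b c) :
    Conn G S a c := ⟨h.1, h.2.trans h'.2⟩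

theorem Conn.of_adj {S : Finset V} {a b : V} (h : G.Adj a b) (ha : a ∉ S) (hb : b ∉ S) :
    Conn G S a b := (Conn.refl ha).step h hb

theorem Conn.symm {S : Finset V} {a b : V} (h : Conn G S a b) : Conn G S b a :=
  (h.induct (P := fun v => v ∉ S ∧ Conn G S v a) ⟨h.1, .refl h.1⟩
    fun _ _ hu huv hv => ⟨hv, (Conn.of_adj huv.symm hv hu.1).trans hu.2⟩).2

/-- A component of `G - S` which avoids `T` is connected in `G - T`. -/
theorem Conn.transfer {S T : Finset V} {a b : V} (h : Conn G S a b)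
    (hT : ∀ v, Conn G S a v → v ∉ T) : Conn G T a b :=
  (h.induct (P := fun v => Conn G S a v ∧ Conn G T a v)
    ⟨.refl h.1, .refl (hT _ (.refl h.1))⟩
    fun _ _ hu huv hv => ⟨hu.1.step huv hv, hu.2.step huv (hT _ (hu.1.step huv hv))⟩).2

theorem Conn.mono {S T : Finset V} (hTS : T ⊆ S) {a b : V} (h : Conn G S a b) : Conn G T a b :=
  h.transfer fun _ hv hvT => hv.right_notMem (hTS hvT)

/-- The component of `a` in `G - S` contains a ray. -/
def Big (G : SimpleGraph V) (S : Finset V) (a : V) : Prop :=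
  ∃ r, IsRay G r ∧ ∀ n, Conn G S a (r n)

theorem Big.notMem {S : Finset V} {a : V} (h : Big G S a) : a ∉ S :=
  let ⟨_, _, h⟩ := h; (h 0).1

theorem Big.congr {S : Finset V} {a b : V} (h : Big G S a) (hab : Conn G S a b) : Big G S b :=
  let ⟨r, hr, h⟩ := h; ⟨r, hr, fun n => hab.symm.trans (h n)⟩

theorem Big.mono {S T : Finset V} (hTS : T ⊆ S) {a : V} (h : Big G S a) : Big G T a :=
  let ⟨r, hr, h⟩ := h; ⟨r, hr, fun n => (h n).mono hTS⟩

theorem Big.transfer {S T : Finset V} {a : V} (h : Big G S a)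
    (hT : ∀ v, Conn G S a v → v ∉ T) : Big G T a :=
  let ⟨r, hr, h⟩ := h; ⟨r, hr, fun n => (h n).transfer hT⟩

theorem IsRay.shift {r : ℕ → V} (hr : IsRay G r) (N : ℕ) : IsRay G (fun n => r (N + n)) :=
  ⟨fun _ _ h => Nat.add_left_cancel (hr.1 h), fun n => hr.2 (N + n)⟩

theorem IsRay.eventually_notMem {r : ℕ → V} (hr : IsRay G r) {S : Set V} (hS : S.Finite) :
    ∃ N, ∀ n, N ≤ n → r n ∉ S := by
  have hfin : {n | r n ∈ S}.Finite := hS.preimage hr.1.injOn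
  obtain ⟨N, hN⟩ := hfin.bddAbove
  exact ⟨N + 1, fun n hn h => by have := hN h; omega⟩

theorem IsRay.eventually_conn {r : ℕ → V} (hr : IsRay G r) (S : Finset V) :
    ∃ N, ∀ n, Conn G S (r N) (r (N + n)) := by
  obtain ⟨N, hN⟩ := hr.eventually_notMem S.finite_toSet
  refine ⟨N, fun n => ?_⟩
  induction n with
  | zero => exact .refl (hN N le_rfl)
  | succ n ih => exact ih.step (hr.2 _) (hN _ (by omega))

theorem Big.refine {S : Finset V} {a : V} (h : Big G S a) (T : Finset V) :
    ∃ b, Conn G S a b ∧ Big G (S ∪ T) b := by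
  obtain ⟨r, hr, h⟩ := h
  obtain ⟨N, hN⟩ := hr.eventually_conn (S ∪ T)
  exact ⟨r N, h N, _, hr.shift N, hN⟩

/-- `G - S` has two distinct components containing rays. -/
def Splits (G : SimpleGraph V) (S : Finset V) : Prop :=
  ∃ a b, Big G S a ∧ Big G S b ∧ ¬ Conn G S a b

/-- The vertex sets of minimal size which separate two ends. -/
def minCuts (G : SimpleGraph V) : Set (Finset V) :=
  {S | Splits G S ∧ ∀ T, Splits G T → S.card ≤ T.card}

theorem exists_big_not_conn {S : Finset V} (hS : Splits G S) (a : V) :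
    ∃ b, Big G S b ∧ ¬ Conn G S a b := by
  obtain ⟨c, d, hc, hd, hcd⟩ := hS
  by_cases h : Conn G S a c
  · exact ⟨d, hd, fun h' => hcd (h.symm.trans h')⟩
  · exact ⟨c, hc, h⟩

/-- Every vertex of a minimal cut has neighbours in each component containing a ray. -/
theorem exists_adj_of_big {S : Finset V} (hS : S ∈ minCuts G) {a s : V} (ha : Big G S a)
    (hs : s ∈ S) : ∃ u, G.Adj s u ∧ Conn G S a u := by
  by_contra hcon
  obtain ⟨b, hb, hab⟩ := exists_big_not_conn hS.1 a
  let T := S.filter fun t => ∃ u, G.Adj t u ∧ Conn G S a u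
  have hTS : T ⊆ S := Finset.filter_subset _ _
  have hlt : T.card < S.card := Finset.card_lt_card
    ⟨hTS, fun h => hcon (Finset.mem_filter.1 (h hs)).2⟩
  refine absurd (hS.2 T ⟨a, b, ha.mono hTS, hb.mono hTS, fun h => hab ?_⟩) (by omega)
  refine h.induct (.refl ha.notMem) fun u v hu huv hv => hu.step huv fun hvS => hv ?_
  exact Finset.mem_filter.2 ⟨hvS, u, huv.symm, hu⟩

theorem conn_of_mem_of_big {S T : Finset V} (hS : S ∈ minCuts G) {a s : V} (ha : Big G S a)
    (hs : s ∈ S) (hsT : s ∉ T) (hT : ∀ v, Conn G S a v → v ∉ T) : Conn G T a s := by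
  obtain ⟨u, hu, hau⟩ := exists_adj_of_big hS ha hs
  exact (hau.transfer hT).step hu.symm hsT

/-- Two elements of `T` lie in distinct components of `G - S`. -/
def Crosses (G : SimpleGraph V) (S T : Finset V) : Prop :=
  ∃ a ∈ T, ∃ b ∈ T, a ∉ S ∧ b ∉ S ∧ ¬ Conn G S a b

theorem exists_mem_conn_of_crosses {S T : Finset V} (hT : T ∈ minCuts G)
    (h : Crosses G S T) {c : V} (hc : Big G T c) : ∃ u ∈ S, Conn G T c u := by
  by_contra! hcon
  obtain ⟨a, ha, b, hb, haS, hbS, hab⟩ := h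
  have key : ∀ v, Conn G T c v → v ∉ S := fun v hv hvS => hcon v hvS hv
  exact hab ((conn_of_mem_of_big hT hc ha haS key).symm.trans
    (conn_of_mem_of_big hT hc hb hbS key))

theorem Crosses.symm {S T : Finset V} (hT : T ∈ minCuts G)
    (h : Crosses G S T) : Crosses G T S := by
  obtain ⟨c, d, hc, hd, hcd⟩ := hT.1
  obtain ⟨u, hu, hcu⟩ := exists_mem_conn_of_crosses hT h hc
  obtain ⟨v, hv, hdv⟩ := exists_mem_conn_of_crosses hT h hd
  exact ⟨u, hu, v, hv, hcu.right_notMem, hdv.right_notMem,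
    fun huv => hcd ((hcu.trans huv).trans hdv.symm)⟩

/-- `T` separates `u` from `v` and each of its elements has neighbours in the components of
`u` and of `v`. -/
def TightSep (G : SimpleGraph V) (u v : V) (T : Finset V) : Prop :=
  u ∉ T ∧ ¬ Conn G T u v ∧
    ∀ t ∈ T, (∃ p, G.Adj t p ∧ Conn G T u p) ∧ ∃ q, G.Adj t q ∧ Conn G T v q

theorem Conn.exists_finset {X : Finset V} {u v : V} (h : Conn G X u v) :
    ∃ F : Finset V, (∀ x ∈ F, x ∉ X) ∧
      ∀ T : Finset V, u ∉ T → Disjoint F T → Conn G T u v := by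
  refine h.induct (P := fun v => ∃ F : Finset V, (∀ x ∈ F, x ∉ X) ∧
      ∀ T : Finset V, u ∉ T → Disjoint F T → Conn G T u v)
    ⟨∅, by simp, fun T hT _ => .refl hT⟩ ?_
  rintro a b ⟨F, hFX, hF⟩ hab hb
  refine ⟨insert b F, Finset.forall_mem_insert .. |>.2 ⟨hb, hFX⟩, fun T hT hd => ?_⟩
  rw [Finset.disjoint_insert_left] at hd
  exact (hF T hT hd.2).step hab hd.1

theorem finite_tightSep_of_subset (u v : V) (n : ℕ) (X : Finset V) :
    {T | X ⊆ T ∧ T.card ≤ X.card + n ∧ TightSep G u v T}.Finite := by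
  induction n generalizing X with
  | zero =>
    refine (finite_singleton X).subset ?_
    rintro T ⟨hXT, hc, -⟩
    exact (Finset.eq_of_subset_of_card_le hXT hc).symm
  | succ n ih =>
    by_cases h : Conn G X u v
    · obtain ⟨F, hFX, hF⟩ := h.exists_finset
      refine (F.finite_toSet.biUnion fun f _ => ih (insert f X)).subset ?_
      rintro T ⟨hXT, hc, hT⟩
      obtain ⟨f, hf, hfT⟩ := Finset.not_disjoint_iff.1 fun hd => hT.2.1 (hF T hT.1 hd)
      refine mem_biUnion hf ⟨Finset.insert_subset hfT hXT, ?_, hT⟩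
      rw [Finset.card_insert_of_notMem (hFX f hf)]
      omega
    · refine (finite_singleton X).subset ?_
      rintro T ⟨hXT, -, hT⟩
      refine (Finset.Subset.antisymm hXT fun t ht => ?_).symm
      by_contra htX
      obtain ⟨⟨p, hp, hup⟩, q, hq, hvq⟩ := hT.2.2 t ht
      exact h (((hup.mono hXT).step hp.symm htX).trans
        ((hvq.mono hXT).step hq.symm htX).symm)

theorem finite_tightSep (u v : V) (n : ℕ) : {T | T.card ≤ n ∧ TightSep G u v T}.Finite :=
  (finite_tightSep_of_subset u v n ∅).subset fun _ h =>
    ⟨Finset.empty_subset _, by simpa using h.1, h.2⟩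

theorem card_eq_of_mem_minCuts {S T : Finset V} (hS : S ∈ minCuts G) (hT : T ∈ minCuts G) :
    S.card = T.card := le_antisymm (hS.2 T hT.1) (hT.2 S hS.1)

theorem tightSep_of_big {S : Finset V} (hS : S ∈ minCuts G) {u v : V} (hu : Big G S u)
    (hv : Big G S v) (huv : ¬ Conn G S u v) : TightSep G u v S :=
  ⟨hu.notMem, huv, fun _ ht => ⟨exists_adj_of_big hS hu ht, exists_adj_of_big hS hv ht⟩⟩

/-- The minimal cuts crossing `S`. -/
def crossing (G : SimpleGraph V) (S : Finset V) : Set (Finset V) :=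
  {T | T ∈ minCuts G ∧ Crosses G T S}

theorem finite_crossing {S : Finset V} (hS : S ∈ minCuts G) : (crossing G S).Finite := by
  refine (S.finite_toSet.biUnion fun u _ => S.finite_toSet.biUnion fun v _ =>
    finite_tightSep (G := G) u v S.card).subset ?_
  rintro T ⟨hT, hTS⟩
  have hST := hTS.symm hS
  obtain ⟨c, d, hc, hd, hcd⟩ := hT.1
  obtain ⟨u, hu, hcu⟩ := exists_mem_conn_of_crosses hT hST hc
  obtain ⟨v, hv, hdv⟩ := exists_mem_conn_of_crosses hT hST hd
  refine mem_biUnion hu (mem_biUnion hv ⟨(card_eq_of_mem_minCuts hT hS).le,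
    tightSep_of_big hT (hc.congr hcu) (hd.congr hdv) fun huv => ?_⟩)
  exact hcd ((hcu.trans huv).trans hdv.symm)

theorem avoids_or_avoids {S T : Finset V} (h : ¬ Crosses G S T) {p q : V}
    (hpq : ¬ Conn G S p q) :
    (∀ v, Conn G S p v → v ∉ T) ∨ ∀ v, Conn G S q v → v ∉ T := by
  by_contra! hcon
  obtain ⟨⟨a, ha, haT⟩, b, hb, hbT⟩ := hcon
  exact h ⟨a, haT, b, hbT, ha.right_notMem, hb.right_notMem,
    fun hab => hpq ((ha.trans hab).trans hb.symm)⟩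

theorem big_of_not_crosses {S T : Finset V} (hS : S ∈ minCuts G)
    (h : ¬ Crosses G S T) {y : V} (hy : y ∈ S) (hyT : y ∉ T) : Big G T y := by
  obtain ⟨c, d, hc, hd, hcd⟩ := hS.1
  rcases avoids_or_avoids h hcd with hav | hav
  · exact (hc.transfer hav).congr (conn_of_mem_of_big hS hc hy hyT hav)
  · exact (hd.transfer hav).congr (conn_of_mem_of_big hS hd hy hyT hav)

/-- A minimal cut crossing neither of two crossing minimal cuts does not separate any two
vertices of their union. -/
theorem conn_of_not_crosses {S S' T : Finset V} (hS' : S' ∈ minCuts G)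
    (hT : T ∈ minCuts G) (hSS' : Crosses G S S') (hTS : ¬ Crosses G T S)
    (hTS' : ¬ Crosses G T S') {x y : V} (hx : x ∈ S ∪ S') (hy : y ∈ S ∪ S')
    (hxT : x ∉ T) (hyT : y ∉ T) : Conn G T x y := by
  have key : ∀ {x y : V}, x ∈ S → y ∈ S' → x ∉ T → y ∉ T → Conn G T x y := by
    intro x y hx hy hxT hyT
    by_contra hxy
    have hbig : Big G T y := big_of_not_crosses hS' (fun h => hTS' (h.symm hT)) hy hyT
    have hav : ∀ v, Conn G T y v → v ∉ S := fun v hv hvS =>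
      hTS ⟨x, hx, v, hvS, hxT, hv.right_notMem, fun h => hxy (h.trans hv.symm)⟩
    have hconn : ∀ p ∈ S', p ∉ S → Conn G S y p := by
      intro p hp hpS
      by_cases hpT : p ∈ T
      · exact conn_of_mem_of_big hT hbig hpT hpS hav
      · refine Conn.transfer (by_contra fun h => ?_) hav
        exact hTS' ⟨y, hy, p, hp, hyT, hpT, h⟩
    obtain ⟨p, hp, q, hq, hpS, hqS, hpq⟩ := hSS'
    exact hpq ((hconn p hp hpS).symm.trans (hconn q hq hqS))
  have same : ∀ {U : Finset V}, ¬ Crosses G T U → ∀ {x y}, x ∈ U → y ∈ U → x ∉ T → y ∉ T →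
      Conn G T x y := fun hU _ _ hx hy hxT hyT =>
    by_contra fun h => hU ⟨_, hx, _, hy, hxT, hyT, h⟩
  rcases Finset.mem_union.1 hx with hx | hx <;> rcases Finset.mem_union.1 hy with hy | hy
  · exact same hTS hx hy hxT hyT
  · exact key hx hy hxT hyT
  · exact (key hy hx hyT hxT).symm
  · exact same hTS' hx hy hxT hyT

/-- `C` and `D` are the two sides of a separation with separator `S`. -/
structure IsSides (G : SimpleGraph V) (S : Finset V) (C D : Set V) : Prop where
  cover : ∀ v, v ∈ C ∨ v ∈ D ∨ v ∈ S
  left : ∀ v ∈ C, v ∉ S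
  right : ∀ v ∈ D, v ∉ S
  disj : ∀ v ∈ C, v ∉ D
  notAdj : ∀ u ∈ C, ∀ v ∈ D, ¬ G.Adj u v

theorem IsSides.symm {S : Finset V} {C D : Set V} (h : IsSides G S C D) : IsSides G S D C :=
  ⟨fun v => by have := h.cover v; tauto, h.right, h.left, fun v hD hC => h.disj v hC hD,
    fun u hu v hv huv => h.notAdj v hv u hu huv.symm⟩

/-- The separator of the corner `C ∩ C'` of two separations with sides `C` and `C'`. -/
noncomputable def corner (S : Finset V) (C : Set V) (S' : Finset V) (C' : Set V) : Finset V :=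
  (S ∪ S').filter fun v => (v ∈ C ∨ v ∈ S) ∧ (v ∈ C' ∨ v ∈ S')

theorem corner_subset (S : Finset V) (C : Set V) (S' : Finset V) (C' : Set V) :
    corner S C S' C' ⊆ S ∪ S' := Finset.filter_subset _ _

theorem corner_comm (S : Finset V) (C : Set V) (S' : Finset V) (C' : Set V) :
    corner S C S' C' = corner S' C' S C := by
  unfold corner
  rw [Finset.union_comm]
  exact Finset.filter_congr fun _ _ => and_comm

theorem mem_of_conn_corner {S S' : Finset V} {C D C' D' : Set V} (h : IsSides G S C D)
    (h' : IsSides G S' C' D') {p v : V} (hp : p ∈ C ∩ C')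
    (hpv : Conn G (corner S C S' C') p v) : v ∈ C ∩ C' := by
  refine hpv.induct hp fun u v hu huv hv => ?_
  have h1 := h.cover v
  have h2 := h'.cover v
  have h3 : v ∉ D := fun hD => h.notAdj u hu.1 v hD huv
  have h4 : v ∉ D' := fun hD => h'.notAdj u hu.2 v hD huv
  simp only [corner, Finset.mem_filter, Finset.mem_union] at hv
  simp only [mem_inter_iff]
  tauto

theorem card_corner {S S' : Finset V} {C D C' D' : Set V} (h : IsSides G S C D)
    (h' : IsSides G S' C' D') :
    (corner S C S' C').card + (corner S D S' D').card = S.card + S'.card := by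
  rw [← Finset.card_union_add_card_inter, ← Finset.card_union_add_card_inter S S']
  congr 2
  · ext v
    have h1 := h.cover v
    have h2 := h'.cover v
    simp only [corner, Finset.mem_union, Finset.mem_filter]
    tauto
  · ext v
    have h1 := h.left v
    have h2 := h'.left v
    have h3 := h.right v
    have h4 := h'.right v
    have h5 := h.disj v
    have h6 := h'.disj v
    simp only [corner, Finset.mem_inter, Finset.mem_union, Finset.mem_filter]
    grind

theorem splits_corner {S S' : Finset V} {C D C' D' : Set V} (h : IsSides G S C D)
    (h' : IsSides G S' C' D') {p q : V} (hp : p ∈ C ∩ C') (hq : q ∈ D ∩ D')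
    (hbp : Big G (S ∪ S') p) (hbq : Big G (S ∪ S') q) : Splits G (corner S C S' C') :=
  ⟨p, q, hbp.mono (corner_subset ..), hbq.mono (corner_subset ..), fun hpq =>
    h.disj q (mem_of_conn_corner h h' hp hpq).1 hq.1⟩

theorem corner_mem_minCuts {S S' : Finset V} (hS : S ∈ minCuts G) (hS' : S' ∈ minCuts G)
    {C D C' D' : Set V} (h : IsSides G S C D)
    (h' : IsSides G S' C' D') {p q : V} (hp : p ∈ C ∩ C') (hq : q ∈ D ∩ D')
    (hbp : Big G (S ∪ S') p) (hbq : Big G (S ∪ S') q) : corner S C S' C' ∈ minCuts G := by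
  have h1 := splits_corner h h' hp hq hbp hbq
  have h2 := splits_corner h.symm h'.symm hq hp hbq hbp
  refine ⟨h1, fun T hT => ?_⟩
  have h3 := card_corner h h'
  have h4 := hS.2 _ h2
  have h5 := hS'.2 T hT
  omega

theorem conn_of_mem_corner {S S' : Finset V} {C D C' D' : Set V} (h : IsSides G S C D)
    (h' : IsSides G S' C' D') {p : V} (hp : p ∈ C ∩ C') (hbp : Big G (S ∪ S') p)
    (hR : corner S C S' C' ∈ minCuts G) {x : V} (hx : x ∈ corner S C S' C') (hxS : x ∉ S') :
    Conn G S' p x :=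
  conn_of_mem_of_big hR (hbp.mono (corner_subset ..)) hx hxS fun _ hv =>
    h'.left _ (mem_of_conn_corner h h' hp hv).2

theorem not_crosses_of_avoids {S' R T : Finset V} (hS' : S' ∈ minCuts G) {p : V}
    (hp : Big G S' p) (hR : ∀ x ∈ R, x ∉ S' → Conn G S' p x)
    (hT : ∀ v, Conn G S' p v → v ∉ T) : ¬ Crosses G T R := by
  have key : ∀ x ∈ R, x ∉ T → Conn G T p x := fun x hx hxT => by
    by_cases hxS : x ∈ S'
    · exact conn_of_mem_of_big hS' hp hxS hxT hT
    · exact (hR x hx hxS).transfer hT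
  rintro ⟨a, ha, b, hb, haT, hbT, hab⟩
  exact hab ((key a ha haT).symm.trans (key b hb hbT))

theorem isSides_comp (S : Finset V) (a : V) :
    IsSides G S {v | Conn G S a v} {v | v ∉ S ∧ ¬ Conn G S a v} where
  cover v := by simp only [mem_ofPred_eq]; tauto
  left v hv := Conn.right_notMem hv
  right v hv := hv.1
  disj v hv h := h.2 hv
  notAdj u hu v hv huv := hv.2 (Conn.step hu huv hv.1)

/-- Two minimal cuts have opposite corners both containing rays. -/
theorem exists_opposite_corners {S S' : Finset V} (hS : S ∈ minCuts G) (hS' : S' ∈ minCuts G) :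
    ∃ C D C' D' : Set V, IsSides G S C D ∧ IsSides G S' C' D' ∧
      (∃ p ∈ C ∩ C', Big G (S ∪ S') p) ∧ ∃ q ∈ D ∩ D', Big G (S ∪ S') q := by
  obtain ⟨a, b, ha, hb, hab⟩ := hS.1
  obtain ⟨a', b', ha', hb', hab'⟩ := hS'.1
  have h := isSides_comp (G := G) S a
  have h' := isSides_comp (G := G) S' a'
  have hbD : b ∈ {v | v ∉ S ∧ ¬ Conn G S a v} := ⟨hb.notMem, hab⟩
  obtain ⟨a₁, ha₁, hA⟩ := ha.refine S'
  obtain ⟨b₁, hb₁, hB⟩ := hb.refine S'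
  obtain ⟨a₂, ha₂, hA'⟩ := ha'.refine S
  obtain ⟨b₂, hb₂, hB'⟩ := hb'.refine S
  have hb₁D : b₁ ∈ {v | v ∉ S ∧ ¬ Conn G S a v} :=
    ⟨hb₁.right_notMem, fun h => hab (h.trans hb₁.symm)⟩
  have hb₂D : b₂ ∈ {v | v ∉ S' ∧ ¬ Conn G S' a' v} :=
    ⟨hb₂.right_notMem, fun h => hab' (h.trans hb₂.symm)⟩
  rw [Finset.union_comm] at hA' hB'
  have hC₁ : a₁ ∈ {v | Conn G S a v} := ha₁
  have hC₂ : a₂ ∈ {v | Conn G S' a' v} := ha₂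
  generalize {v | Conn G S a v} = C, {v | v ∉ S ∧ ¬ Conn G S a v} = D,
    {v | Conn G S' a' v} = C', {v | v ∉ S' ∧ ¬ Conn G S' a' v} = D' at *
  have hc : ∀ {v}, Big G (S ∪ S') v → (v ∈ C ∨ v ∈ D) ∧ (v ∈ C' ∨ v ∈ D') := fun {v} hv => by
    have h1 := hv.notMem
    have h2 := h.cover v
    have h3 := h'.cover v
    simp only [Finset.mem_union] at h1
    tauto
  by_cases hcase : (∃ p ∈ C ∩ C', Big G (S ∪ S') p) ∧ ∃ q ∈ D ∩ D', Big G (S ∪ S') q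
  · exact ⟨C, D, C', D', h, h', hcase⟩
  · refine ⟨C, D, D', C', h, h'.symm, ?_⟩
    by_contra hcase'
    have h1 := hc hA
    have h2 := hc hB
    have h3 := hc hA'
    have h4 := hc hB'
    simp only [mem_inter_iff] at hcase hcase'
    grind

/-- The minimal cuts which are crossed by as few minimal cuts as possible. -/
def optCuts (G : SimpleGraph V) : Set (Finset V) :=
  {S | S ∈ minCuts G ∧ ∀ T ∈ minCuts G, (crossing G S).ncard ≤ (crossing G T).ncard}

theorem IsSides.mem_of_conn {S : Finset V} {C D : Set V} (h : IsSides G S C D) {u v : V}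
    (hu : u ∈ C) (huv : Conn G S u v) : v ∈ C :=
  huv.induct hu fun a b ha hab hb => ((h.cover b).resolve_right fun hbD =>
    hbD.elim (fun hbD => h.notAdj a ha b hbD hab) hb)

theorem IsSides.not_conn {S : Finset V} {C D : Set V} (h : IsSides G S C D) {u v : V}
    (hu : u ∈ C) (hv : v ∈ D) : ¬ Conn G S u v := fun huv => h.disj v (h.mem_of_conn hu huv) hv

theorem crosses_of_crosses_corners {S R R' T : Finset V} (hS : S ∈ minCuts G)
    (hT : T ∈ minCuts G) {p q : V} (hp : Big G S p) (hq : Big G S q)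
    (hpq : ¬ Conn G S p q) (hR : ∀ x ∈ R, x ∉ S → Conn G S p x)
    (hR' : ∀ x ∈ R', x ∉ S → Conn G S q x) (hTR : Crosses G T R) (hTR' : Crosses G T R') :
    Crosses G T S := by
  by_contra hcon
  rcases avoids_or_avoids (fun h => hcon (h.symm hT)) hpq with hav | hav
  · exact not_crosses_of_avoids hS hp hR hav hTR
  · exact not_crosses_of_avoids hS hq hR' hav hTR'

theorem optCuts_not_crosses {S S' : Finset V} (hS : S ∈ optCuts G) (hS' : S' ∈ optCuts G) :
    ¬ Crosses G S S' := by
  intro hcr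
  obtain ⟨C, D, C', D', h, h', ⟨p, hp, hbp⟩, q, hq, hbq⟩ := exists_opposite_corners hS.1 hS'.1
  have hR := corner_mem_minCuts hS.1 hS'.1 h h' hp hq hbp hbq
  have hR' := corner_mem_minCuts hS.1 hS'.1 h.symm h'.symm hq hp hbq hbp
  have hx := fun x => conn_of_mem_corner h h' hp hbp hR (x := x)
  have hx' := fun x => conn_of_mem_corner h.symm h'.symm hq hbq hR' (x := x)
  have hy := fun x (hx : x ∈ corner S C S' C') => conn_of_mem_corner h' h hp.symm
    (by rwa [Finset.union_comm]) (by rwa [corner_comm]) (x := x) (by rwa [corner_comm])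
  have hy' := fun x (hx : x ∈ corner S D S' D') => conn_of_mem_corner h'.symm h.symm hq.symm
    (by rwa [Finset.union_comm]) (by rwa [corner_comm]) (x := x) (by rwa [corner_comm])
  have hsub := corner_subset S C S' C'
  have hsub' := corner_subset S D S' D'
  generalize corner S C S' C' = R, corner S D S' D' = R' at *
  have hpS := hbp.mono (T := S) Finset.subset_union_left
  have hqS := hbq.mono (T := S) Finset.subset_union_left
  have hpS' := hbp.mono (T := S') Finset.subset_union_right
  have hqS' := hbq.mono (T := S') Finset.subset_union_right
  have hinter : crossing G R ∩ crossing G R' ⊆ crossing G S ∩ crossing G S' := by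
    rintro T ⟨⟨hT, hTR⟩, -, hTR'⟩
    exact ⟨⟨hT, crosses_of_crosses_corners hS.1 hT hpS hqS (h.not_conn hp.1 hq.1)
      hy hy' hTR hTR'⟩, hT, crosses_of_crosses_corners hS'.1 hT hpS' hqS'
      (h'.not_conn hp.2 hq.2) hx hx' hTR hTR'⟩
  have hunion : crossing G R ∪ crossing G R' ⊂ crossing G S ∪ crossing G S' := by
    refine ⟨?_, fun hss => ?_⟩
    · rintro T hT
      have hTm : T ∈ minCuts G := hT.elim And.left And.left
      by_contra hcon
      have hconn := @conn_of_not_crosses _ _ _ _ _ hS'.1 hTm hcr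
        (fun h => hcon (.inl ⟨hTm, h⟩)) (fun h => hcon (.inr ⟨hTm, h⟩))
      rcases hT with ⟨-, a, ha, b, hb, haT, hbT, hab⟩ | ⟨-, a, ha, b, hb, haT, hbT, hab⟩
      · exact hab (hconn (hsub ha) (hsub hb) haT hbT)
      · exact hab (hconn (hsub' ha) (hsub' hb) haT hbT)
    · rcases hss (.inl ⟨hS'.1, hcr.symm hS'.1⟩) with hc | hc
      · exact not_crosses_of_avoids hS'.1 hpS' hx (fun _ => Conn.right_notMem) hc.2
      · exact not_crosses_of_avoids hS'.1 hqS' hx' (fun _ => Conn.right_notMem) hc.2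
  have hfin := (finite_crossing hS.1).union (finite_crossing hS'.1)
  have h1 := ncard_lt_ncard hunion hfin
  have h2 := ncard_le_ncard hinter ((finite_crossing hS.1).inter_of_left _)
  have h3 := ncard_union_add_ncard_inter _ _ (finite_crossing hR) (finite_crossing hR')
  have h4 := ncard_union_add_ncard_inter _ _ (finite_crossing hS.1) (finite_crossing hS'.1)
  have h5 := hS.2 R hR
  have h6 := hS'.2 R' hR'
  omega

theorem optCuts_nonempty {S : Finset V} (hS : Splits G S) : (optCuts G).Nonempty := by
  obtain ⟨S, hS, hmin⟩ := exists_minimalFor_of_wellFoundedLT (Splits G) Finset.card ⟨S, hS⟩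
  have hS' : S ∈ minCuts G := ⟨hS, fun T hT => (le_total _ _).elim id (hmin hT)⟩
  obtain ⟨T, hT, hmin⟩ := exists_minimalFor_of_wellFoundedLT (· ∈ minCuts G)
    (fun S => (crossing G S).ncard) ⟨S, hS'⟩
  exact ⟨T, hT, fun U hU => (le_total _ _).elim id (hmin hU)⟩

/-- The image of a finite vertex set under an automorphism. -/
def imgCut (φ : G ≃g G) (S : Finset V) : Finset V := S.map φ.toEquiv.toEmbedding

variable (φ : G ≃g G)

@[simp]
theorem mem_imgCut {S : Finset V} {v : V} : φ v ∈ imgCut φ S ↔ v ∈ S :=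
  Finset.mem_map' φ.toEquiv.toEmbedding

theorem imgCut_symm (S : Finset V) : imgCut φ.symm (imgCut φ S) = S := by
  ext v
  obtain ⟨w, rfl⟩ := φ.symm.surjective v
  rw [mem_imgCut]
  obtain ⟨w, rfl⟩ := φ.surjective w
  simp

theorem imgCut_symm' (S : Finset V) : imgCut φ (imgCut φ.symm S) = S := imgCut_symm φ.symm S

theorem card_imgCut (S : Finset V) : (imgCut φ S).card = S.card := Finset.card_map _

theorem Conn.img {S : Finset V} {a b : V} (h : Conn G S a b) :
    Conn G (imgCut φ S) (φ a) (φ b) :=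
  h.induct (P := fun v => Conn G (imgCut φ S) (φ a) (φ v)) (.refl (by simpa using h.1))
    fun u v hu huv hv => hu.step (φ.map_adj_iff.2 huv) (by simpa using hv)

theorem conn_imgCut {S : Finset V} {a b : V} :
    Conn G (imgCut φ S) (φ a) (φ b) ↔ Conn G S a b := by
  refine ⟨fun h => ?_, fun h => h.img φ⟩
  have := h.img φ.symm
  rwa [imgCut_symm, φ.symm_apply_apply, φ.symm_apply_apply] at this

theorem Big.img {S : Finset V} {a : V} (h : Big G S a) : Big G (imgCut φ S) (φ a) :=
  let ⟨r, hr, h⟩ := h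
  ⟨fun n => φ (r n), ⟨φ.injective.comp hr.1, fun n => φ.map_adj_iff.2 (hr.2 n)⟩,
    fun n => (h n).img φ⟩

theorem Splits.img {S : Finset V} (h : Splits G S) : Splits G (imgCut φ S) :=
  let ⟨a, b, ha, hb, hab⟩ := h
  ⟨φ a, φ b, ha.img φ, hb.img φ, by rwa [conn_imgCut]⟩

theorem minCuts_img {S : Finset V} (h : S ∈ minCuts G) : imgCut φ S ∈ minCuts G := by
  refine ⟨h.1.img φ, fun T hT => ?_⟩
  have := h.2 _ (hT.img φ.symm)
  rwa [card_imgCut] at this ⊢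

theorem Crosses.img {S T : Finset V} (h : Crosses G S T) :
    Crosses G (imgCut φ S) (imgCut φ T) := by
  obtain ⟨a, ha, b, hb, haS, hbS, hab⟩ := h
  refine ⟨φ a, ?_, φ b, ?_, ?_, ?_, ?_⟩ <;> simpa [conn_imgCut]

theorem crossing_imgCut (S : Finset V) :
    crossing G (imgCut φ S) = imgCut φ '' crossing G S := by
  ext T
  constructor
  · rintro ⟨hT, hTS⟩
    refine ⟨imgCut φ.symm T, ⟨minCuts_img _ hT, ?_⟩, imgCut_symm' ..⟩
    have := hTS.img φ.symm
    rwa [imgCut_symm] at this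
  · rintro ⟨T, ⟨hT, hTS⟩, rfl⟩
    exact ⟨minCuts_img _ hT, hTS.img φ⟩

theorem imgCut_injective : Function.Injective (imgCut φ) :=
  Function.LeftInverse.injective (imgCut_symm φ)

theorem optCuts_img {S : Finset V} (h : S ∈ optCuts G) : imgCut φ S ∈ optCuts G :=
  ⟨minCuts_img φ h.1, fun T hT => by
    rw [crossing_imgCut, ncard_image_of_injective _ (imgCut_injective φ)]
    exact h.2 T hT⟩

theorem Conn.induce_reachable {S : Finset V} {C : Set V} {a b : V} (h : Conn G S a b)
    (hC : ∀ v, Conn G S a v → v ∈ C) :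
    (G.induce C).Reachable ⟨a, hC a (.refl h.1)⟩ ⟨b, hC b h⟩ := by
  have key : ∃ hb : Conn G S a b, (G.induce C).Reachable ⟨a, hC a (.refl h.1)⟩ ⟨b, hC b hb⟩ := by
    refine h.induct (P := fun b => ∃ hb : Conn G S a b,
      (G.induce C).Reachable ⟨a, hC a (.refl h.1)⟩ ⟨b, hC b hb⟩) ⟨.refl h.1, .refl _⟩ ?_
    rintro u v ⟨hu, hr⟩ huv hv
    exact ⟨hu.step huv hv, hr.trans (SimpleGraph.Adj.reachable (by simpa using huv))⟩
  exact key.2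

theorem conn_of_induce_reachable {S : Finset V} {C : Set V} (hC : C ⊆ {v | v ∉ S}) {a b : C}
    (h : (G.induce C).Reachable a b) : Conn G S a b := by
  obtain ⟨w⟩ := h
  induction w with
  | nil => exact .refl (hC (Subtype.coe_prop _))
  | @cons u v _ h _ ih => exact (Conn.of_adj (G := G) (a := u.1) h (hC u.2) ih.1).trans ih

theorem isCompOf_conn {S : Finset V} {a : V} (ha : a ∉ S) :
    IsCompOf G {v | Conn G S a v} {v | v ∉ S} := by
  have hr : ∀ v : {v | Conn G S a v}, (G.induce {v | Conn G S a v}).Reachable ⟨a, .refl ha⟩ v :=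
    fun v => Conn.induce_reachable v.2 fun _ h => h
  refine ⟨⟨a, .refl ha⟩, fun v hv => hv.right_notMem, ?_, fun C' hCC' hC' hconn => ?_⟩
  · exact (SimpleGraph.connected_iff_exists_forall_reachable _).2 ⟨⟨a, .refl ha⟩, hr⟩
  · exact (hCC'.antisymm fun v hv => conn_of_induce_reachable hC'
      (hconn.preconnected ⟨a, hCC' (.refl ha)⟩ ⟨v, hv⟩)).symm

/-- Two inequivalent rays have tails in distinct components after removing a finite set. -/
theorem exists_not_conn_of_not_rayEquiv {r r' : ℕ → V} (hr : IsRay G r) (hr' : IsRay G r')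
    (h : ¬ RayEquiv G r r') :
    ∃ S : Finset V, ∀ N M, (∀ n, N ≤ n → r n ∉ S) → (∀ n, M ≤ n → r' n ∉ S) →
      ¬ Conn G S (r N) (r' M) := by
  contrapose! h
  intro S
  obtain ⟨N, M, hN, hM, hc⟩ := h S
  have tail : ∀ {q : ℕ → V} {K}, IsRay G q → (∀ n, K ≤ n → q n ∉ S) →
      ∀ n, K ≤ n → Conn G S (q K) (q n) := by
    intro q K hq hK n hn
    induction n, hn using Nat.le_induction with
    | base => exact .refl (hK K le_rfl)
    | succ n hn ih => exact ih.step (hq.2 n) (hK _ (by omega))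
  exact ⟨{v | Conn G S (r N) v}, isCompOf_conn hc.1, ⟨N, tail hr hN⟩,
    M, fun n hn => hc.trans (tail hr' hM n hn)⟩

theorem exists_splits (h : InfinitelyManyEnds G) : ∃ S, Splits G S := by
  obtain ⟨f, hf, hne⟩ := h 2
  obtain ⟨S, hS⟩ := exists_not_conn_of_not_rayEquiv (hf 0) (hf 1) (hne 0 1 (by simp))
  obtain ⟨N, hN⟩ := (hf 0).eventually_conn S
  obtain ⟨M, hM⟩ := (hf 1).eventually_conn S
  refine ⟨S, f 0 N, f 1 M, ⟨_, (hf 0).shift N, hN⟩, ⟨_, (hf 1).shift M, hM⟩, hS N M ?_ ?_⟩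
  · intro n hn
    simpa [Nat.add_sub_cancel' hn] using (hN (n - N)).right_notMem
  · intro n hn
    simpa [Nat.add_sub_cancel' hn] using (hM (n - M)).right_notMem

end VertexCuts

section Homogeneous

variable {V : Type u} {G : SimpleGraph V} {E : V → V → Prop}

/-- Some optimal cut separates `x` from `y`. -/
def Sepd (G : SimpleGraph V) (x y : V) : Prop :=
  ∃ S ∈ optCuts G, x ∉ S ∧ y ∉ S ∧ ¬ Conn G S x y

theorem Sepd.symm {x y : V} : Sepd G x y → Sepd G y x := fun ⟨S, hS, hx, hy, h⟩ =>
  ⟨S, hS, hy, hx, fun h' => h h'.symm⟩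

theorem Sepd.ne {x y : V} : Sepd G x y → x ≠ y := by
  rintro ⟨S, -, hx, -, h⟩ rfl
  exact h (.refl hx)

theorem Sepd.img (φ : G ≃g G) {x y : V} : Sepd G x y → Sepd G (φ x) (φ y) :=
  fun ⟨S, hS, hx, hy, h⟩ => ⟨imgCut φ S, optCuts_img φ hS, by simpa, by simpa, by rwa [conn_imgCut]⟩

/-- Optimal cuts are not separated by optimal cuts. -/
theorem not_sep_of_mem {S : Finset V} (hS : S ∈ optCuts G) {x y : V} (hx : x ∈ S) (hy : y ∈ S) :
    ¬ Sepd G x y := fun ⟨_, hT, hxT, hyT, h⟩ =>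
  optCuts_not_crosses hT hS ⟨x, hx, y, hy, hxT, hyT, h⟩

theorem nonempty_of_mem_optCuts (hG : G.Connected) {S : Finset V} (hS : S ∈ optCuts G) :
    S.Nonempty := by
  rw [Finset.nonempty_iff_ne_empty]
  rintro rfl
  obtain ⟨a, b, -, -, h⟩ := hS.1.1
  have key : ∀ {a b : V}, G.Walk a b → Conn G ∅ a b := fun w => by
    induction w with
    | nil => exact .refl (by simp)
    | cons h _ ih => exact (Conn.of_adj h (by simp) (by simp)).trans ih
  exact h (key (hG.preconnected a b).some)

/-- `f 0, f 1, …, f n` is a directed walk. -/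
def IsDW (E : V → V → Prop) (n : ℕ) (f : ℕ → V) : Prop := ∀ i < n, E (f i) (f (i + 1))

/-- There is a directed walk of length `n` from `x` to `y`. -/
def DW (E : V → V → Prop) (n : ℕ) (x y : V) : Prop := ∃ f, IsDW E n f ∧ f 0 = x ∧ f n = y

theorem DW.zero (x : V) : DW E 0 x x := ⟨fun _ => x, fun _ h => by omega, rfl, rfl⟩

theorem eq_of_dw_zero {x y : V} : DW E 0 x y → x = y := by
  rintro ⟨f, -, rfl, rfl⟩
  rfl

theorem DW.cons {n : ℕ} {x y z : V} (hxy : E x y) : DW E n y z → DW E (n + 1) x z := by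
  rintro ⟨f, hf, rfl, rfl⟩
  refine ⟨fun i => i.casesOn x f, fun i hi => ?_, rfl, rfl⟩
  cases i with
  | zero => exact hxy
  | succ i => exact hf i (by omega)

theorem DW.flip {n : ℕ} {x y : V} : DW E n x y → DW (flip E) n y x := by
  rintro ⟨f, hf, rfl, rfl⟩
  refine ⟨fun i => f (n - i), fun i hi => ?_, by simp, by simp⟩
  have := hf (n - (i + 1)) (by omega)
  rwa [show n - (i + 1) + 1 = n - i by omega] at this

theorem DW.snoc {n : ℕ} {x y z : V} (h : DW E n x y) (hyz : E y z) : DW E (n + 1) x z :=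
  (h.flip.cons (E := _root_.flip E) hyz).flip

theorem IsDW.dw {n : ℕ} {f : ℕ → V} (hf : IsDW E n f) {i j : ℕ} (hij : i ≤ j) (hj : j ≤ n) :
    DW E (j - i) (f i) (f j) :=
  ⟨fun k => f (i + k), fun k hk => hf (i + k) (by omega), rfl, by simp [Nat.add_sub_cancel' hij]⟩

theorem DW.exists_cons {n : ℕ} {x z : V} : DW E (n + 1) x z → ∃ y, E x y ∧ DW E n y z := by
  rintro ⟨f, hf, rfl, rfl⟩
  exact ⟨f 1, hf 0 (by omega), hf.dw (Nat.le_add_left 1 n) le_rfl⟩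

theorem DW.exists_snoc {n : ℕ} {x z : V} (h : DW E (n + 1) x z) : ∃ y, DW E n x y ∧ E y z :=
  let ⟨y, hy, h⟩ := h.flip.exists_cons; ⟨y, h.flip, hy⟩

theorem exists_dw_iff {x y : V} : (∃ n, DW E n x y) ↔ Relation.ReflTransGen E x y := by
  constructor
  · rintro ⟨n, h⟩
    induction n generalizing x with
    | zero => rw [eq_of_dw_zero h]
    | succ n ih =>
      obtain ⟨z, hz, h⟩ := h.exists_cons
      exact (ih h).head hz
  · intro h
    induction h using Relation.ReflTransGen.head_induction_on with
    | refl => exact ⟨0, .zero _⟩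
    | head h _ ih => exact ih.imp' (· + 1) fun _ => .cons h

/-- The consequences of C-homogeneity for a triangle-free digraph `E` with underlying graph `G`
that are used below. -/
structure IsHomDigraph (G : SimpleGraph V) (E : V → V → Prop) : Prop where
  adj_iff : ∀ x y, G.Adj x y ↔ E x y ∨ E y x
  connected : G.Connected
  ends : InfinitelyManyEnds G
  vertex : ∀ x x', ∃ φ : G ≃g G, (∀ a b, E (φ a) (φ b) ↔ E a b) ∧ φ x = x'
  arc : ∀ {x y z x' y' z'}, E x y → E y z → E x' y' → E y' z' →
    ∃ φ : G ≃g G, (∀ a b, E (φ a) (φ b) ↔ E a b) ∧ φ x = x' ∧ φ y = y' ∧ φ z = z'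
  outPair : ∀ {x a b x' a' b'}, E x a → E x b → a ≠ b → E x' a' → E x' b' → a' ≠ b' →
    ∃ φ : G ≃g G, (∀ a b, E (φ a) (φ b) ↔ E a b) ∧ φ a = a' ∧ φ b = b'
  inPair : ∀ {x a b x' a' b'}, E a x → E b x → a ≠ b → E a' x' → E b' x' → a' ≠ b' →
    ∃ φ : G ≃g G, (∀ a b, E (φ a) (φ b) ↔ E a b) ∧ φ a = a' ∧ φ b = b'

namespace IsHomDigraph

theorem flip (h : IsHomDigraph G E) : IsHomDigraph G (flip E) where
  adj_iff x y := (h.adj_iff x y).trans or_comm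
  connected := h.connected
  ends := h.ends
  vertex x x' := let ⟨φ, hφ, hx⟩ := h.vertex x x'; ⟨φ, fun _ _ => hφ _ _, hx⟩
  arc h1 h2 h3 h4 := let ⟨φ, hφ, hx, hy, hz⟩ := h.arc h2 h1 h4 h3
    ⟨φ, fun _ _ => hφ _ _, hz, hy, hx⟩
  outPair h1 h2 h3 h4 h5 h6 := let ⟨φ, hφ, hx⟩ := h.inPair h1 h2 h3 h4 h5 h6
    ⟨φ, fun _ _ => hφ _ _, hx⟩
  inPair h1 h2 h3 h4 h5 h6 := let ⟨φ, hφ, hx⟩ := h.outPair h1 h2 h3 h4 h5 h6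
    ⟨φ, fun _ _ => hφ _ _, hx⟩

variable (h : IsHomDigraph G E)
include h

theorem adj {x y : V} (hxy : E x y) : G.Adj x y := (h.adj_iff x y).2 (.inl hxy)

theorem irrefl (x : V) : ¬ E x x := fun hx => G.irrefl (h.adj hx)

theorem exists_out (x : V) : ∃ y, E x y := by
  obtain ⟨f, hf, -⟩ := h.ends 1
  have hab := (hf 0).2 0
  obtain ⟨a, b, hab⟩ : ∃ a b, E a b :=
    ((h.adj_iff _ _).1 hab).elim (fun h => ⟨_, _, h⟩) fun h => ⟨_, _, h⟩
  obtain ⟨φ, hφ, rfl⟩ := h.vertex a x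
  exact ⟨φ b, (hφ a b).2 hab⟩

theorem exists_in (x : V) : ∃ y, E y x := h.flip.exists_out x

theorem exists_optCut : ∃ S, S ∈ optCuts G :=
  let ⟨_, hS⟩ := exists_splits h.ends; optCuts_nonempty hS

theorem false_of_not_sep (h2 : ∀ x y z, E x y → E y z → ¬ Sepd G x z)
    (hin : ∀ x y z, E x y → E z y → ¬ Sepd G x z) : False := by
  have hclosed : ∀ S ∈ optCuts G, ∀ s ∈ S, ∀ y, E y s → y ∈ S := by
    intro S hS s hs y hy
    by_contra hyS
    obtain ⟨c, hc, hyc⟩ := exists_big_not_conn hS.1.1 y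
    obtain ⟨u, hsu, hcu⟩ := exists_adj_of_big hS.1 hc hs
    have hsep : Sepd G y u :=
      ⟨S, hS, hyS, hcu.right_notMem, fun hyu => hyc (hyu.trans hcu.symm)⟩
    rcases (h.adj_iff _ _).1 hsu with hsu | hus
    · exact h2 _ _ _ hy hsu hsep
    · exact hin _ _ _ hy hus hsep
  obtain ⟨S, hS⟩ := h.exists_optCut
  obtain ⟨s, hs⟩ := nonempty_of_mem_optCuts h.connected hS
  have hsub : {y | Relation.ReflTransGen E y s} ⊆ S := fun y hy => by
    induction hy using Relation.ReflTransGen.head_induction_on with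
    | refl => exact hs
    | head hab _ ih => exact hclosed S hS _ ih _ hab
  obtain ⟨c, -, hc, -⟩ := hS.1.1
  obtain ⟨u, hsu, hcu⟩ := exists_adj_of_big hS.1 hc hs
  have hsu : E s u := ((h.adj_iff _ _).1 hsu).resolve_right fun hus =>
    hcu.right_notMem (hclosed S hS s hs u hus)
  obtain ⟨φ, hφ, hφu⟩ := h.vertex s u
  have himg : {y | Relation.ReflTransGen E y u} = φ '' {y | Relation.ReflTransGen E y s} := by
    subst hφu
    ext y
    obtain ⟨y, rfl⟩ := φ.surjective y
    rw [φ.injective.mem_set_image]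
    constructor
    · intro hy
      have := Relation.ReflTransGen.lift (r := E) (p := E) φ.symm (fun a b hab => by
        rwa [Function.onFun, ← hφ, φ.apply_symm_apply, φ.apply_symm_apply]) _ _ hy
      simpa [Function.onFun] using this
    · exact fun hy => Relation.ReflTransGen.lift φ (fun a b hab => (hφ a b).2 hab) _ _ hy
  have hfin := S.finite_toSet.subset hsub
  have heq := eq_of_subset_of_ncard_le (s := {y | Relation.ReflTransGen E y s})
    (t := {y | Relation.ReflTransGen E y u}) (fun y hy => Relation.ReflTransGen.tail hy hsu)
    (by rw [himg, ncard_image_of_injective _ φ.injective]) (by rw [himg]; exact hfin.image _)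
  have hu : u ∈ {y | Relation.ReflTransGen E y u} := .refl
  rw [← heq] at hu
  exact hcu.right_notMem (hsub hu)

/-- The ends of a directed path of length two are separated. -/
theorem sep_of_arc {x y z : V} (hxy : E x y) (hyz : E y z) : Sepd G x z := by
  suffices hs : ∃ x y z, E x y ∧ E y z ∧ Sepd G x z by
    obtain ⟨a, b, c, hab, hbc, hs⟩ := hs
    obtain ⟨φ, -, rfl, -, rfl⟩ := h.arc hab hbc hxy hyz
    exact hs.img φ
  by_contra! h2
  by_cases hin : ∀ x y z, E x y → E z y → ¬ Sepd G x z
  · exact h.false_of_not_sep h2 hin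
  by_cases hout : ∀ x y z, E y x → E y z → ¬ Sepd G x z
  · exact h.flip.false_of_not_sep (fun x y z hyx hzy hs => h2 z y x hzy hyx hs.symm) hout
  push Not at hin hout
  obtain ⟨p, z, q, hpz, hqz, hpq⟩ := hin
  obtain ⟨a, y, b, hya, hyb, S, hS, ha, hb, hab⟩ := hout
  have hy : y ∈ S := by
    by_contra hy
    exact hab ((Conn.of_adj (h.adj hya).symm ha hy).step (h.adj hyb) hb)
  have hmem : ∀ w, E w y → w ∈ S := by
    intro w hw
    by_contra hwS
    by_cases hwa : Conn G S w a
    · exact h2 w y b hw hyb ⟨S, hS, hwS, hb, fun hwb => hab (hwa.symm.trans hwb)⟩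
    · exact h2 w y a hw hya ⟨S, hS, hwS, ha, hwa⟩
  obtain ⟨φ, hφ, rfl⟩ := h.vertex z y
  exact not_sep_of_mem hS (hmem _ ((hφ _ _).2 hpz)) (hmem _ ((hφ _ _).2 hqz)) (hpq.img φ)

theorem conn_walk {S : Finset V} {f : ℕ → V} {i j : ℕ} (hij : i ≤ j)
    (hf : ∀ k, i ≤ k → k < j → E (f k) (f (k + 1))) (hS : ∀ k, i ≤ k → k ≤ j → f k ∉ S) :
    Conn G S (f i) (f j) := by
  induction j, hij using Nat.le_induction with
  | base => exact .refl (hS i le_rfl le_rfl)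
  | succ j hij ih =>
    exact (ih (fun k h1 h2 => hf k h1 (by omega)) fun k h1 h2 => hS k h1 (by omega)).step
      (h.adj (hf j hij (by omega))) (hS _ (by omega) le_rfl)

theorem sep_of_isDW {n : ℕ} {f : ℕ → V} (hf : IsDW E n f) (hn : 2 ≤ n) :
    Sepd G (f 0) (f n) := by
  induction n using Nat.strong_induction_on generalizing f with
  | _ n ih =>
  obtain ⟨S, hS, h0, h2, h02⟩ := h.sep_of_arc (hf 0 (by omega)) (hf 1 (by omega))
  have h1 : f 1 ∈ S := by
    by_contra h1
    exact h02 ((Conn.of_adj (h.adj (hf 0 (by omega))) h0 h1).step (h.adj (hf 1 (by omega))) h2)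
  by_cases hj : ∃ j, 3 ≤ j ∧ j ≤ n ∧ f j ∈ S
  · obtain ⟨j, hj3, hjn, hj⟩ := hj
    have := ih (j - 1) (by omega) (f := fun i => f (1 + i)) (fun i hi => hf (1 + i) (by omega))
      (by omega)
    rw [show 1 + (j - 1) = j by omega] at this
    exact absurd this (not_sep_of_mem hS h1 hj)
  · push Not at hj
    have hns : ∀ k, 2 ≤ k → k ≤ n → f k ∉ S := fun k hk hkn => by
      rcases hk.eq_or_lt with rfl | hk
      exacts [h2, hj k hk hkn]
    have hc := h.conn_walk hn (fun k _ hk => hf k hk) hns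
    exact ⟨S, hS, h0, hns n hn le_rfl, fun h0n => h02 (h0n.trans hc.symm)⟩

theorem sep_of_dw {n : ℕ} {x y : V} (hxy : DW E n x y) (hn : 2 ≤ n) : Sepd G x y := by
  obtain ⟨f, hf, rfl, rfl⟩ := hxy
  exact h.sep_of_isDW hf hn

theorem ne_of_dw {n : ℕ} {x y : V} (hxy : DW E n x y) (hn : 1 ≤ n) : x ≠ y := by
  rcases hn.eq_or_lt with rfl | hn
  · rintro rfl
    obtain ⟨y, hy, hxy⟩ := hxy.exists_cons
    rw [eq_of_dw_zero hxy] at hy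
    exact h.irrefl _ hy
  · exact (h.sep_of_dw hxy hn).ne

theorem injOn_of_isDW {n : ℕ} {f : ℕ → V} (hf : IsDW E n f) {i j : ℕ} (hi : i ≤ n) (hj : j ≤ n)
    (hij : f i = f j) : i = j := by
  rcases lt_trichotomy i j with hlt | heq | hlt
  · exact absurd hij (h.ne_of_dw (hf.dw hlt.le hj) (by omega))
  · exact heq
  · exact absurd hij.symm (h.ne_of_dw (hf.dw hlt.le hi) (by omega))

theorem not_edge_of_reflTransGen {x y : V} (hxy : Relation.ReflTransGen E x y) : ¬ E y x := by
  intro hyx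
  obtain ⟨n, hn⟩ := exists_dw_iff.2 hxy
  exact h.ne_of_dw (hn.snoc hyx) (by omega) rfl

theorem not_sep_of_common {x a b y : V} (hxa : E x a) (hxb : E x b)
    (hay : Relation.ReflTransGen E a y) (hby : Relation.ReflTransGen E b y) : ¬ Sepd G a b := by
  rintro ⟨S, hS, ha, hb, hab⟩
  have hx : x ∈ S := by
    by_contra hx
    exact hab ((Conn.of_adj (h.adj hxa).symm ha hx).step (h.adj hxb) hb)
  have key : ∀ {c}, E x c → c ∉ S → Relation.ReflTransGen E c y → Conn G S c y := by
    intro c hxc hc hcy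
    obtain ⟨n, f, hf, rfl, rfl⟩ := exists_dw_iff.2 hcy
    refine h.conn_walk n.zero_le (fun k _ hk => hf k hk) fun k _ hk hkS => ?_
    cases k with
    | zero => exact hc hkS
    | succ k =>
      exact not_sep_of_mem hS hx hkS (h.sep_of_dw ((hf.dw (Nat.zero_le _) hk).cons hxc) (by omega))
  exact hab ((key hxa ha hay).trans (key hxb hb hby).symm)

end IsHomDigraph

/-- Any two out-neighbours of a vertex have a common descendant. -/
def CommonDesc (E : V → V → Prop) : Prop :=
  ∀ z a b, E z a → E z b → ∃ y, Relation.ReflTransGen E a y ∧ Relation.ReflTransGen E b y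

namespace IsHomDigraph

variable (h : IsHomDigraph G E)
include h

theorem commonDesc_of_exists {z a b y : V} (hza : E z a) (hzb : E z b) (hab : a ≠ b)
    (ha : Relation.ReflTransGen E a y) (hb : Relation.ReflTransGen E b y) : CommonDesc E := by
  intro z' a' b' hza' hzb'
  by_cases hab' : a' = b'
  · exact ⟨a', .refl, by rw [hab']⟩
  obtain ⟨φ, hφ, rfl, rfl⟩ := h.outPair hza hzb hab hza' hzb' hab'
  have hl : ∀ {a}, Relation.ReflTransGen E a y → Relation.ReflTransGen E (φ a) (φ y) :=
    fun ha => Relation.ReflTransGen.lift (p := E) φ (fun a b hab => (hφ a b).2 hab) _ _ ha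
  exact ⟨φ y, hl ha, hl hb⟩

theorem commonDesc {x u u' y : V} (hu : Relation.ReflTransGen E x u)
    (hu' : Relation.ReflTransGen E x u') (huy : E u y) (huy' : E u' y) (hne : u ≠ u') :
    CommonDesc E := by
  have base : ∀ {u u'}, E u y → E u' y → u ≠ u' → Relation.ReflTransGen E u u' →
      CommonDesc E := by
    intro u u' huy huy' hne huu'
    rcases Relation.ReflTransGen.cases_head huu' with rfl | ⟨c, huc, hcu'⟩
    · exact absurd rfl hne
    · refine h.commonDesc_of_exists huc huy ?_ (hcu'.tail huy') .refl
      rintro rfl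
      exact h.not_edge_of_reflTransGen hcu' huy'
  induction hu using Relation.ReflTransGen.head_induction_on with
  | refl => exact base huy huy' hne hu'
  | @head x c hxc hcu ih =>
    rcases Relation.ReflTransGen.cases_head hu' with rfl | ⟨c', hxc', hcu'⟩
    · exact base huy' huy hne.symm (hcu.head hxc)
    · by_cases hcc' : c = c'
      · exact ih (hcc' ▸ hcu')
      · exact h.commonDesc_of_exists hxc hxc' hcc' (hcu.tail huy) (hcu'.tail huy')

theorem commonDesc_flip {x u u' y : V} (hu : Relation.ReflTransGen E x u)
    (hu' : Relation.ReflTransGen E x u') (huy : E u y) (huy' : E u' y) (hne : u ≠ u') :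
    CommonDesc (_root_.flip E) :=
  h.flip.commonDesc_of_exists huy huy' hne (Relation.reflTransGen_swap.2 hu)
    (Relation.reflTransGen_swap.2 hu')

theorem not_sep_out (hc : CommonDesc E) {z a b : V} (hza : E z a) (hzb : E z b) :
    ¬ Sepd G a b :=
  let ⟨_, ha, hb⟩ := hc z a b hza hzb
  h.not_sep_of_common hza hzb ha hb

end IsHomDigraph

theorem DW.append {m n : ℕ} {x y z : V} (h : DW E m x y) (h' : DW E n y z) :
    DW E (m + n) x z := by
  induction n generalizing z with
  | zero => rwa [← eq_of_dw_zero h']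
  | succ n ih =>
    obtain ⟨w, hw, hwz⟩ := h'.exists_snoc
    exact (ih hw).snoc hwz

/-- The optimal cuts separating `x` from `y`. -/
def sepCuts (G : SimpleGraph V) (x y : V) : Set (Finset V) :=
  {S | S ∈ optCuts G ∧ x ∉ S ∧ y ∉ S ∧ ¬ Conn G S x y}

/-- The optimal cuts containing `x`. -/
def cutsAt (G : SimpleGraph V) (x : V) : Set (Finset V) := {S | S ∈ optCuts G ∧ x ∈ S}

theorem sepCuts_img (φ : G ≃g G) (x y : V) :
    sepCuts G (φ x) (φ y) = imgCut φ '' sepCuts G x y := by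
  ext S
  obtain ⟨S, rfl⟩ : ∃ T, imgCut φ T = S := ⟨_, imgCut_symm' φ S⟩
  rw [(imgCut_injective φ).mem_set_image]
  simp only [sepCuts, mem_ofPred_eq, mem_imgCut, conn_imgCut]
  refine and_congr_left fun _ => ⟨fun h => ?_, optCuts_img φ⟩
  have := optCuts_img φ.symm h
  rwa [imgCut_symm] at this

theorem cutsAt_img (φ : G ≃g G) (x : V) : cutsAt G (φ x) = imgCut φ '' cutsAt G x := by
  ext S
  obtain ⟨S, rfl⟩ : ∃ T, imgCut φ T = S := ⟨_, imgCut_symm' φ S⟩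
  rw [(imgCut_injective φ).mem_set_image]
  simp only [cutsAt, mem_ofPred_eq, mem_imgCut]
  refine and_congr_left fun _ => ⟨fun h => ?_, optCuts_img φ⟩
  have := optCuts_img φ.symm h
  rwa [imgCut_symm] at this

/-- Homogeneous digraphs in which out-neighbours have common descendants and in-neighbours have
common ancestors. -/
structure IsMerging (G : SimpleGraph V) (E : V → V → Prop) : Prop extends IsHomDigraph G E where
  desc : CommonDesc E
  asc : CommonDesc (_root_.flip E)

namespace IsMerging

theorem flip (h : IsMerging G E) : IsMerging G (flip E) where
  toIsHomDigraph := h.toIsHomDigraph.flip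
  desc := h.asc
  asc := h.desc

variable (h : IsMerging G E)
include h

theorem conn_out {S : Finset V} (hS : S ∈ optCuts G) {s v w : V} (hv : E s v) (hw : E s w)
    (hvS : v ∉ S) (hwS : w ∉ S) : Conn G S v w :=
  by_contra fun hvw => h.not_sep_out h.desc hv hw ⟨S, hS, hvS, hwS, hvw⟩

theorem conn_in {S : Finset V} (hS : S ∈ optCuts G) {s v w : V} (hv : E v s) (hw : E w s)
    (hvS : v ∉ S) (hwS : w ∉ S) : Conn G S v w := h.flip.conn_out hS hv hw hvS hwS

theorem exists_in_out {S : Finset V} (hS : S ∈ optCuts G) {s : V} (hs : s ∈ S) :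
    ∃ u v, E u s ∧ E s v ∧ Big G S u ∧ Big G S v ∧ ¬ Conn G S u v := by
  obtain ⟨c, d, hc, hd, hcd⟩ := hS.1.1
  obtain ⟨u, hsu, hcu⟩ := exists_adj_of_big hS.1 hc hs
  obtain ⟨v, hsv, hdv⟩ := exists_adj_of_big hS.1 hd hs
  have hu := hc.congr hcu
  have hv := hd.congr hdv
  have huv : ¬ Conn G S u v := fun huv => hcd ((hcu.trans huv).trans hdv.symm)
  rcases (h.adj_iff _ _).1 hsu with hsu | hsu <;> rcases (h.adj_iff _ _).1 hsv with hsv | hsv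
  · exact absurd (h.conn_out hS hsu hsv hu.notMem hv.notMem) huv
  · exact ⟨v, u, hsv, hsu, hv, hu, fun hvu => huv hvu.symm⟩
  · exact ⟨u, v, hsu, hsv, hu, hv, huv⟩
  · exact absurd (h.conn_in hS hsu hsv hu.notMem hv.notMem) huv

theorem big_out {S : Finset V} (hS : S ∈ optCuts G) {s v : V} (hs : s ∈ S) (hv : E s v)
    (hvS : v ∉ S) : Big G S v :=
  let ⟨_, _, _, hsw, _, hw, _⟩ := h.exists_in_out hS hs
  hw.congr (h.conn_out hS hsw hv hw.notMem hvS)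

theorem big_in {S : Finset V} (hS : S ∈ optCuts G) {s v : V} (hs : s ∈ S) (hv : E v s)
    (hvS : v ∉ S) : Big G S v := h.flip.big_out hS hs hv hvS

theorem not_conn_arc {S : Finset V} (hS : S ∈ optCuts G) {x s y : V} (hs : s ∈ S) (hx : E x s)
    (hy : E s y) (hxS : x ∉ S) (hyS : y ∉ S) : ¬ Conn G S x y := by
  obtain ⟨u, v, hus, hsv, hu, hv, huv⟩ := h.exists_in_out hS hs
  exact fun hxy => huv (((h.conn_in hS hus hx hu.notMem hxS).trans hxy).trans
    (h.conn_out hS hy hsv hyS hv.notMem))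

theorem mem_of_sepCuts {S : Finset V} {x a y : V} (hxa : E x a) (hay : E a y)
    (hS : S ∈ sepCuts G x y) : a ∈ S := by
  by_contra ha
  exact hS.2.2.2 ((Conn.of_adj (h.adj hxa) hS.2.1 ha).step (h.adj hay) hS.2.2.1)

theorem finite_sepCuts {x a y : V} (hxa : E x a) (hay : E a y) : (sepCuts G x y).Finite := by
  obtain ⟨T, hT⟩ := h.exists_optCut
  refine (finite_tightSep (G := G) x y T.card).subset fun S hS => ?_
  have ha := h.mem_of_sepCuts hxa hay hS
  exact ⟨(card_eq_of_mem_minCuts hS.1.1 hT.1).le, tightSep_of_big hS.1.1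
    (h.big_in hS.1 ha hxa hS.2.1) (h.big_out hS.1 ha hay hS.2.2.1) hS.2.2.2⟩

/-- Optimal cuts are independent. -/
theorem not_edge_of_mem {S : Finset V} (hS : S ∈ optCuts G) {a b : V} (ha : a ∈ S)
    (hb : b ∈ S) : ¬ E a b := by
  intro hab
  obtain ⟨x, b', hxa, hab', hx, hb', hxb'⟩ := h.exists_in_out hS ha
  obtain ⟨φ, -, hφx, -, hφb⟩ := h.arc hxa hab hxa hab'
  have hSm : S ∈ sepCuts G x b' := ⟨hS, hx.notMem, hb'.notMem, hxb'⟩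
  obtain ⟨T, hT, hTn⟩ : ∃ T ∈ sepCuts G x b, T ∉ sepCuts G x b' := by
    by_contra! hsub
    have heq := eq_of_subset_of_ncard_le hsub
      (by nth_rw 1 [← hφx, ← hφb, sepCuts_img, ncard_image_of_injective _ (imgCut_injective φ)])
      (h.finite_sepCuts hxa hab')
    rw [← heq] at hSm
    exact hSm.2.2.1 hb
  have haT := h.mem_of_sepCuts hxa hab hT
  have hb'T : b' ∈ T := by
    by_contra hb'T
    exact hTn ⟨hT.1, hT.2.1, hb'T, h.not_conn_arc hT.1 haT hxa hab' hT.2.1 hb'T⟩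
  have h1 : ∀ v, Conn G S x v → v ∉ T := fun v hv hvT => hxb' <| hv.trans <| by_contra fun hn =>
    not_sep_of_mem hT.1 hvT hb'T ⟨S, hS, hv.right_notMem, hb'.notMem, hn⟩
  have h2 : ∀ v, Conn G T x v → v ∉ S := fun v hv hvS => hT.2.2.2 <| hv.trans <|
    by_contra fun hn => not_sep_of_mem hS hvS hb ⟨T, hT.1, hv.right_notMem, hT.2.2.1, hn⟩
  exact h2 b (conn_of_mem_of_big hS.1 hx hb hT.2.2.1 h1) hb

theorem cutsAt_eq {x a y : V} (hxa : E x a) (hay : E a y) : cutsAt G a = sepCuts G x y := by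
  ext S
  refine ⟨fun ⟨hS, ha⟩ => ?_, fun hS => ⟨hS.1, h.mem_of_sepCuts hxa hay hS⟩⟩
  have hx : x ∉ S := fun hx => h.not_edge_of_mem hS hx ha hxa
  have hy : y ∉ S := fun hy => h.not_edge_of_mem hS ha hy hay
  exact ⟨hS, hx, hy, h.not_conn_arc hS ha hxa hay hx hy⟩

theorem finite_cutsAt (a : V) : (cutsAt G a).Finite := by
  obtain ⟨x, hx⟩ := h.exists_in a
  obtain ⟨y, hy⟩ := h.exists_out a
  rw [h.cutsAt_eq hx hy]
  exact h.finite_sepCuts hx hy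

theorem cutsAt_nonempty (a : V) : (cutsAt G a).Nonempty := by
  obtain ⟨S, hS⟩ := h.exists_optCut
  obtain ⟨s, hs⟩ := nonempty_of_mem_optCuts h.connected hS
  obtain ⟨φ, -, rfl⟩ := h.vertex s a
  exact ⟨_, optCuts_img φ hS, by simpa⟩

theorem exists_mem_notMem {a b : V} (hab : cutsAt G a ≠ cutsAt G b) :
    ∃ S ∈ optCuts G, a ∈ S ∧ b ∉ S := by
  by_contra! hsub
  obtain ⟨φ, -, rfl⟩ := h.vertex a b
  refine hab (eq_of_subset_of_ncard_le (fun S hS => ⟨hS.1, hsub S hS.1 hS.2⟩) ?_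
    (h.finite_cutsAt _))
  rw [cutsAt_img, ncard_image_of_injective _ (imgCut_injective φ)]

theorem eq_of_mem {S : Finset V} (hS : S ∈ optCuts G) {n : ℕ} {f : ℕ → V} (hf : IsDW E n f)
    {i j : ℕ} (hi : i ≤ n) (hj : j ≤ n) (hiS : f i ∈ S) (hjS : f j ∈ S) : i = j := by
  have key : ∀ {i j}, i ≤ n → j ≤ n → f i ∈ S → f j ∈ S → ¬ i < j := by
    intro i j hi hj hiS hjS hij
    rcases Nat.lt_or_ge (i + 1) j with hlt | hge
    · exact not_sep_of_mem hS hiS hjS (h.sep_of_dw (hf.dw hij.le hj) (by omega))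
    · obtain rfl : j = i + 1 := by omega
      exact h.not_edge_of_mem hS hiS hjS (hf i (by omega))
  have := key hi hj hiS hjS
  have := key hj hi hjS hiS
  omega

theorem conn_before {S : Finset V} (hS : S ∈ optCuts G) {n : ℕ} {f : ℕ → V} (hf : IsDW E n f)
    {i j : ℕ} (hi : i ≤ n) (hiS : f i ∈ S) (hj : j < i) : Conn G S (f 0) (f j) :=
  h.conn_walk j.zero_le (fun k _ hk => hf k (by omega)) fun k _ hk hkS => by
    have := h.eq_of_mem hS hf hi (by omega) hiS hkS
    omega

theorem conn_after {S : Finset V} (hS : S ∈ optCuts G) {n : ℕ} {f : ℕ → V} (hf : IsDW E n f)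
    {i j : ℕ} (hiS : f i ∈ S) (hij : i < j) (hj : j ≤ n) : Conn G S (f j) (f n) :=
  h.conn_walk hj (fun k _ hk => hf k hk) fun k hjk hk hkS => by
    have := h.eq_of_mem hS hf (by omega) hk hiS hkS
    omega

theorem not_conn_walk {S : Finset V} (hS : S ∈ optCuts G) {n : ℕ} {f : ℕ → V} (hf : IsDW E n f)
    {i : ℕ} (hi : 0 < i) (hin : i < n) (hiS : f i ∈ S) : ¬ Conn G S (f 0) (f n) := by
  have h1 := h.conn_before hS hf hin.le hiS (Nat.sub_lt hi one_pos)
  have h2 := h.conn_after hS hf hiS (Nat.lt_succ_self i) hin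
  have h3 := hf (i - 1) (by omega)
  rw [Nat.sub_add_cancel hi] at h3
  exact fun hc => h.not_conn_arc hS hiS h3 (hf i hin) h1.right_notMem h2.1
    ((h1.symm.trans hc).trans h2.symm)

/-- An optimal cut meeting the interior of a directed walk meets the interior of all directed
walks with the same ends. -/
theorem exists_mem_walk {S : Finset V} (hS : S ∈ optCuts G) {m n : ℕ} {f g : ℕ → V}
    (hf : IsDW E m f) (hg : IsDW E n g) (h0 : f 0 = g 0) (h1 : f m = g n) {i : ℕ} (hi : 0 < i)
    (him : i < m) (hiS : f i ∈ S) : ∃ j, 0 < j ∧ j < n ∧ g j ∈ S := by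
  by_contra! hcon
  have hc := h.not_conn_walk hS hf hi him hiS
  have hf0 : f 0 ∉ S := (h.conn_before hS hf him.le hiS hi).1
  have hfm : f m ∉ S := (h.conn_after hS hf hiS him le_rfl).1
  rw [h0] at hc hf0
  rw [h1] at hc hfm
  refine hc (h.conn_walk n.zero_le (fun k _ hk => hg k hk) fun k _ hk => ?_)
  rcases k.eq_zero_or_pos with rfl | hk0
  · exact hf0
  · rcases hk.eq_or_lt with rfl | hk
    · exact hfm
    · exact hcon k hk0 hk

theorem cutsAt_walk {m n : ℕ} {f g : ℕ → V} (hf : IsDW E m f) (hg : IsDW E n g)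
    (h0 : f 0 = g 0) (h1 : f m = g n) {i : ℕ} (him : i < m) (hin : i < n) :
    cutsAt G (f i) = cutsAt G (g i) := by
  induction i using Nat.strong_induction_on with
  | _ i ih =>
  rcases i.eq_zero_or_pos with rfl | hi
  · rw [h0]
  by_contra hne
  obtain ⟨S, hS, hfS, hgS⟩ := h.exists_mem_notMem hne
  obtain ⟨T, hT, hgT, hfT⟩ := h.exists_mem_notMem (Ne.symm hne)
  have key : ∀ {S}, S ∈ optCuts G → ∀ {m n : ℕ} {f g : ℕ → V}, IsDW E m f → IsDW E n g →
      f 0 = g 0 → f m = g n → i < m →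
      (∀ j < i, j < m → j < n → cutsAt G (f j) = cutsAt G (g j)) → f i ∈ S → g i ∉ S →
      ∃ j, i < j ∧ j < n ∧ g j ∈ S := by
    intro S hS m n f g hf hg h0 h1 him ih hfS hgS
    obtain ⟨j, hj, hjn, hgj⟩ := h.exists_mem_walk hS hf hg h0 h1 hi him hfS
    refine ⟨j, ?_, hjn, hgj⟩
    by_contra hij
    rcases (not_lt.1 hij).eq_or_lt with rfl | hij
    · exact hgS hgj
    · have hmem : S ∈ cutsAt G (f j) := by
        rw [ih j hij (by omega) hjn]
        exact ⟨hS, hgj⟩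
      have := h.eq_of_mem hS hf (by omega) (by omega) hmem.2 hfS
      omega
  obtain ⟨j, hij, hjn, hgj⟩ := key hS hf hg h0 h1 him ih hfS hgS
  obtain ⟨l, hil, hlm, hfl⟩ := key hT hg hf h0.symm h1.symm hin
    (fun j hj hjn hjm => (ih j hj hjm hjn).symm) hgT hfT
  have hc1 := h.conn_before hS hg hjn.le hgj hij
  have hc2 := h.conn_after hS hf hfS hil hlm.le
  refine not_sep_of_mem hT hgT hfl ⟨S, hS, hgS, hc2.1, fun hc => ?_⟩
  refine h.not_conn_walk hS hf hi him hfS ?_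
  rw [h0]
  exact (hc1.trans hc).trans hc2

theorem exists_dw (n : ℕ) (x : V) : ∃ y, DW E n x y := by
  induction n with
  | zero => exact ⟨x, .zero x⟩
  | succ n ih =>
    obtain ⟨y, hy⟩ := ih
    obtain ⟨z, hz⟩ := h.exists_out y
    exact ⟨z, hy.snoc hz⟩

theorem cutsAt_level {n : ℕ} {v u u' : V} (hu : DW E n v u) (hu' : DW E n v u') :
    cutsAt G u = cutsAt G u' := by
  induction n generalizing v u u' with
  | zero => rw [← eq_of_dw_zero hu, ← eq_of_dw_zero hu']
  | succ n ih =>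
    obtain ⟨a, hva, ha⟩ := hu.exists_cons
    obtain ⟨a', hva', ha'⟩ := hu'.exists_cons
    obtain ⟨y, hay, hay'⟩ := h.desc v a a' hva hva'
    obtain ⟨p, hp⟩ := exists_dw_iff.2 hay
    obtain ⟨q, hq⟩ := exists_dw_iff.2 hay'
    obtain ⟨z, hz⟩ := h.exists_dw (n + 1) y
    obtain ⟨f, hf, rfl, hfz⟩ := hp.append hz
    obtain ⟨g, hg, rfl, hgz⟩ := hq.append hz
    have hcons : ∀ {k} {f : ℕ → V}, E v (f 0) → IsDW E k f →
        IsDW E (k + 1) (fun i => i.casesOn v f) := fun {k f} hv hf i hi => by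
      cases i with
      | zero => exact hv
      | succ i => exact hf i (by omega)
    have heq : cutsAt G (f n) = cutsAt G (g n) :=
      h.cutsAt_walk (hcons hva hf) (hcons hva' hg) rfl (hfz.trans hgz.symm) (i := n + 1)
        (by omega) (by omega)
    rw [ih ha (hf.dw n.zero_le (by omega)), heq]
    exact ih (hg.dw n.zero_le (by omega)) ha'

theorem cutsAt_level' {n : ℕ} {v u u' : V} (hu : DW E n u v) (hu' : DW E n u' v) :
    cutsAt G u = cutsAt G u' := h.flip.cutsAt_level hu.flip hu'.flip

end IsMerging

/-- A graph with a function of bounded fibres changing by at most one along edges does not have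
infinitely many ends. -/
theorem not_infinitelyManyEnds {m : V → ℕ} {c : ℕ} (hadj : ∀ u v, G.Adj u v → m v ≤ m u + 1)
    (hfib : ∀ k, ∃ A : Finset V, A.card ≤ c ∧ ∀ v, m v = k → v ∈ A) :
    ¬ InfinitelyManyEnds G := by
  intro hG
  obtain ⟨f, hf, hne⟩ := hG (c + 1)
  choose F hF using fun i j hij => exists_not_conn_of_not_rayEquiv (hf i) (hf j) (hne i j hij)
  have hfin : (⋃ i, ⋃ j, ⋃ hij : i ≠ j, (F i j hij : Set V)).Finite :=
    finite_iUnion fun i => finite_iUnion fun j => finite_iUnion fun hij =>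
      (F i j hij).finite_toSet
  choose N hN using fun i => (hf i).eventually_notMem hfin
  have hN' : ∀ i j (hij : i ≠ j), (∀ n, N i ≤ n → f i n ∉ F i j hij) ∧
      ∀ n, N j ≤ n → f j n ∉ F i j hij := fun i j hij =>
    ⟨fun n hn hmem => hN i n hn (mem_iUnion₂.2 ⟨i, j, mem_iUnion.2 ⟨hij, hmem⟩⟩),
      fun n hn hmem => hN j n hn (mem_iUnion₂.2 ⟨i, j, mem_iUnion.2 ⟨hij, hmem⟩⟩)⟩
  let k := Finset.univ.sup fun i => m (f i (N i))
  have hk : ∀ i, ∃ n, N i ≤ n ∧ m (f i n) = k := by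
    intro i
    by_contra! hcon
    have hlt : ∀ n, N i ≤ n → m (f i n) < k := by
      intro n hn
      induction n, hn using Nat.le_induction with
      | base => exact lt_of_le_of_ne (Finset.le_sup (f := fun i => m (f i (N i)))
          (Finset.mem_univ i)) (hcon _ le_rfl)
      | succ n hn ih =>
        have := hadj _ _ ((hf i).2 n)
        have := hcon (n + 1) (by omega)
        omega
    choose A _ hA using hfib
    have hfin' : {v | m v < k}.Finite :=
      ((finite_Iio k).biUnion fun l _ => (A l).finite_toSet).subset fun v hv =>
        mem_biUnion hv (hA _ v rfl)
    obtain ⟨M, hM⟩ := (hf i).eventually_notMem hfin'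
    exact hM (max M (N i)) (le_max_left _ _) (hlt _ (le_max_right _ _))
  choose n hn hnk using hk
  obtain ⟨A, hAc, hA⟩ := hfib k
  have hinj : Function.Injective fun i => f i (n i) := by
    intro i j hij
    by_contra hne
    obtain ⟨h1, h2⟩ := hN' i j hne
    refine hF i j hne (n i) (n j) (fun l hl => h1 l ((hn i).trans hl))
      (fun l hl => h2 l ((hn j).trans hl)) ?_
    simp only at hij
    rw [← hij]
    exact .refl (h1 _ (hn i))
  have hcard := Finset.card_le_card_of_injOn (s := Finset.univ) (t := A) (fun i => f i (n i))
    (fun i _ => hA _ (hnk i)) hinj.injOn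
  simp only [Finset.card_univ, Fintype.card_fin] at hcard
  omega

/-- `v` behaves as a vertex of level `n` with respect to the two-way infinite walk `z`. -/
def HasLevel (G : SimpleGraph V) (E : V → V → Prop) (z : ℤ → V) (v : V) (n : ℤ) : Prop :=
  ∀ (m : ℕ) (u : V), (DW E m v u → cutsAt G u = cutsAt G (z (n + m))) ∧
    (DW E m u v → cutsAt G u = cutsAt G (z (n - m)))

theorem HasLevel.cutsAt_eq {z : ℤ → V} {v : V} {n : ℤ} (h : HasLevel G E z v n) :
    cutsAt G v = cutsAt G (z n) := by
  simpa using (h 0 v).1 (.zero v)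

theorem HasLevel.flip {z : ℤ → V} {v : V} {n : ℤ} (hv : HasLevel G E z v n) :
    HasLevel G (_root_.flip E) (fun i => z (-i)) v (-n) := by
  refine fun m u => ⟨fun hu => ?_, fun hu => ?_⟩
  · rw [(hv m u).2 hu.flip]
    ring_nf
  · rw [(hv m u).1 hu.flip]
    ring_nf

namespace IsMerging

variable (h : IsMerging G E)
include h

theorem exists_biinfinite (x : V) : ∃ z : ℤ → V, z 0 = x ∧ ∀ n, E (z n) (z (n + 1)) := by
  choose s hs using h.exists_out
  choose p hp using h.exists_in
  refine ⟨fun n => Int.casesOn n (fun n => s^[n] x) fun n => p^[n + 1] x, rfl, fun n => ?_⟩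
  rcases n with n | n | n
  · change E (s^[n] x) (s^[n + 1] x)
    rw [Function.iterate_succ_apply']
    exact hs _
  · exact hp x
  · change E (p^[n + 2] x) (p^[n + 1] x)
    rw [Function.iterate_succ_apply']
    exact hp _

theorem hasLevel_succ {z : ℤ → V} {v w : V} {n : ℤ} (hv : HasLevel G E z v n) (hvw : E v w) :
    HasLevel G E z w (n + 1) := by
  refine fun m u => ⟨fun hu => ?_, fun hu => ?_⟩
  · rw [((hv (m + 1) u).1 (hu.cons hvw))]
    push_cast
    ring_nf
  · cases m with
    | zero =>
      rw [eq_of_dw_zero hu, (hv 1 w).1 ((DW.zero w).cons hvw)]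
      simp
    | succ m =>
      obtain ⟨t, ht⟩ := h.flip.exists_dw m v
      rw [h.cutsAt_level' hu (DW.snoc (E := E) ht.flip hvw), (hv m t).2 ht.flip]
      push_cast
      ring_nf

theorem hasLevel_pred {z : ℤ → V} {v w : V} {n : ℤ} (hv : HasLevel G E z v n) (hwv : E w v) :
    HasLevel G E z w (n - 1) := by
  have := (h.flip.hasLevel_succ hv.flip hwv).flip
  simp only [neg_neg] at this
  rwa [show -(-n + 1) = n - 1 by ring] at this

theorem hasLevel_walk {z : ℤ → V} (hz : ∀ n, E (z n) (z (n + 1))) (n : ℤ) :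
    HasLevel G E z (z n) n := by
  have hw : ∀ (n : ℤ) (m : ℕ), DW E m (z n) (z (n + m)) := fun n m =>
    ⟨fun i => z (n + i), fun i _ => by have := hz (n + i); push_cast; rwa [← add_assoc],
      by simp, rfl⟩
  refine fun m u => ⟨fun hu => h.cutsAt_level hu (hw n m), fun hu => h.cutsAt_level' hu ?_⟩
  have := hw (n - m) m
  rwa [sub_add_cancel] at this

theorem exists_hasLevel {z : ℤ → V} (hz : ∀ n, E (z n) (z (n + 1))) (v : V) :
    ∃ n, HasLevel G E z v n := by
  obtain ⟨w⟩ := h.connected.preconnected v (z 0)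
  generalize hx : z 0 = x at w
  induction w with
  | nil => exact ⟨0, hx ▸ h.hasLevel_walk hz 0⟩
  | cons huv _ ih =>
    obtain ⟨n, hn⟩ := ih hx
    rcases (h.adj_iff _ _).1 huv with huv | huv
    · exact ⟨n - 1, h.hasLevel_pred hn huv⟩
    · exact ⟨n + 1, h.hasLevel_succ hn huv⟩

protected theorem false : False := by
  classical
  obtain ⟨T, hT⟩ := h.exists_optCut
  obtain ⟨x, -⟩ := nonempty_of_mem_optCuts h.connected hT
  obtain ⟨z, -, hz⟩ := h.exists_biinfinite x
  have hex : ∀ v, ∃ k n, Int.natAbs n = k ∧ HasLevel G E z v n := fun v =>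
    let ⟨n, hn⟩ := h.exists_hasLevel hz v; ⟨_, n, rfl, hn⟩
  refine not_infinitelyManyEnds (m := fun v => Nat.find (hex v)) (c := 2 * T.card) ?_ ?_ h.ends
  · intro u v huv
    obtain ⟨n, hn, hu⟩ := Nat.find_spec (hex u)
    obtain ⟨l, hl, hv⟩ : ∃ l, Int.natAbs l ≤ n.natAbs + 1 ∧ HasLevel G E z v l := by
      rcases (h.adj_iff _ _).1 huv with huv | huv
      · exact ⟨n + 1, by omega, h.hasLevel_succ hu huv⟩
      · exact ⟨n - 1, by omega, h.hasLevel_pred hu huv⟩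
    have := Nat.find_min' (hex v) ⟨l, rfl, hv⟩
    omega
  · intro k
    obtain ⟨S, hS, hSz⟩ := h.cutsAt_nonempty (z k)
    obtain ⟨S', hS', hSz'⟩ := h.cutsAt_nonempty (z (-k))
    refine ⟨S ∪ S', ?_, fun v hv => ?_⟩
    · have h1 := Finset.card_union_le S S'
      have h2 := card_eq_of_mem_minCuts hS.1 hT.1
      have h3 := card_eq_of_mem_minCuts hS'.1 hT.1
      omega
    · obtain ⟨n, hn, hvn⟩ := Nat.find_spec (hex v)
      change Nat.find (hex v) = k at hv
      rw [hv] at hn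
      have heq := hvn.cutsAt_eq
      rw [Finset.mem_union]
      rcases Int.natAbs_eq n with hk | hk <;> rw [hn] at hk <;> rw [hk] at heq
      · have hmem : S ∈ cutsAt G v := heq ▸ ⟨hS, hSz⟩
        exact .inl hmem.2
      · have hmem : S' ∈ cutsAt G v := heq ▸ ⟨hS', hSz'⟩
        exact .inr hmem.2

end IsMerging

namespace IsHomDigraph

variable (h : IsHomDigraph G E)
include h

theorem parent_unique {x u u' y : V} (hu : Relation.ReflTransGen E x u)
    (hu' : Relation.ReflTransGen E x u') (huy : E u y) (huy' : E u' y) : u = u' :=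
  by_contra fun hne => IsMerging.false (G := G) (E := E)
    ⟨h, h.commonDesc hu hu' huy huy' hne, h.commonDesc_flip hu hu' huy huy' hne⟩

theorem descendants_eq (x : V) : Descendants E x = {y | Relation.ReflTransGen E x y} := by
  ext y
  constructor
  · rintro ⟨n, p, hp, rfl, rfl⟩
    exact exists_dw_iff.1 ⟨n, p, hp.2, rfl, rfl⟩
  · intro hy
    obtain ⟨n, p, hp, rfl, rfl⟩ := exists_dw_iff.2 hy
    exact ⟨n, p, ⟨fun i j hi hj => h.injOn_of_isDW hp hi hj, hp⟩, rfl, rfl⟩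

theorem isTree_desc (x : V) : (G.induce {y | Relation.ReflTransGen E x y}).IsTree := by
  refine ⟨(SimpleGraph.connected_iff_exists_forall_reachable _).2 ⟨⟨x, .refl⟩, ?_⟩, ?_⟩
  · rintro ⟨y, hy⟩
    induction hy with
    | refl => exact .refl _
    | tail hxy hyz ih =>
      refine ih.trans (SimpleGraph.Adj.reachable ?_)
      exact h.adj hyz
  · rw [SimpleGraph.isAcyclic_iff_forall_adj_isBridge]
    have key : ∀ u v : {y | Relation.ReflTransGen E x y}, E u v →
        (G.induce {y | Relation.ReflTransGen E x y}).IsBridge s(u, v) := by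
      intro u v huv
      rw [SimpleGraph.isBridge_iff]
      intro hr
      obtain ⟨w⟩ := hr.symm
      have hvs : ∀ {a b}, ((G.induce {y | Relation.ReflTransGen E x y}).deleteEdges
          {s(u, v)}).Walk a b → Relation.ReflTransGen E v.1 a → Relation.ReflTransGen E v.1 b := by
        intro a b w
        induction w with
        | nil => exact id
        | @cons a b _ hab _ ih =>
          refine fun ha => ih ?_
          obtain ⟨hab, hne⟩ := (SimpleGraph.deleteEdges_adj).1 hab
          rcases (h.adj_iff _ _).1 hab with hab | hba
          · exact ha.tail hab
          · rcases Relation.ReflTransGen.cases_tail ha with heq | ⟨c, hvc, hca⟩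
            · obtain rfl : a = v := Subtype.ext heq
              obtain rfl : b = u := Subtype.ext (h.parent_unique b.2 u.2 hba huv)
              exact absurd Sym2.eq_swap hne
            · rwa [h.parent_unique b.2 (Relation.ReflTransGen.trans v.2 hvc) hba hca]
      exact h.not_edge_of_reflTransGen (hvs w .refl) huv
    intro u v huv
    rcases (h.adj_iff _ _).1 huv with huv | huv
    · exact key u v huv
    · rw [Sym2.eq_swap]
      exact key v u huv

end IsHomDigraph

theorem connected_induce_range {ι : Type*} (f : ι → V) (i₀ : ι)
    (hf : ∀ i, i ≠ i₀ → G.Adj (f i₀) (f i)) : (G.induce (range f)).Connected := by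
  refine (SimpleGraph.connected_iff_exists_forall_reachable _).2 ⟨⟨f i₀, i₀, rfl⟩, ?_⟩
  rintro ⟨_, i, rfl⟩
  by_cases hi : i = i₀
  · subst hi
    exact .refl _
  · exact SimpleGraph.Adj.reachable (hf i hi)

/-- An isomorphism between two induced stars in a C-homogeneous digraph extends to an
automorphism. -/
theorem DigraphCHom.exists_iso (hE : DigraphCHom E) {ι : Type*} [Finite ι] {f g : ι → V}
    (hf : Function.Injective f) (hg : Function.Injective g) (i₀ : ι)
    (hadj : ∀ i, i ≠ i₀ → (UG E).Adj (f i₀) (f i))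
    (hfg : ∀ i j, E (f i) (f j) ↔ E (g i) (g j)) :
    ∃ φ : UG E ≃g UG E, (∀ a b, E (φ a) (φ b) ↔ E a b) ∧ ∀ i, φ (f i) = g i := by
  obtain ⟨ψ, hψ, hψf⟩ := hE (range f) (range g) (finite_range f) (finite_range g)
    (connected_induce_range f i₀ hadj)
    ((Equiv.ofInjective f hf).symm.trans (Equiv.ofInjective g hg)) (by
      rintro ⟨_, i, rfl⟩ ⟨_, j, rfl⟩
      simpa [Equiv.ofInjective_symm_apply] using hfg i j)
  refine ⟨⟨ψ, by simp [UG, hψ]⟩, hψ, fun i => ?_⟩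
  have := hψf ⟨f i, i, rfl⟩
  simpa [Equiv.ofInjective_symm_apply] using this

theorem isHomDigraph (hD : IsDigraph E) (hconn : (UG E).Connected) (hhom : DigraphCHom E)
    (htf : ¬ HasTriangle E) (hends : InfinitelyManyEnds (UG E)) : IsHomDigraph (UG E) E := by
  have hadj : ∀ x y, (UG E).Adj x y ↔ E x y ∨ E y x := fun x y => by
    simp only [UG, SimpleGraph.fromRel_adj, and_iff_right_iff_imp]
    rintro h rfl
    exact hD.1 x (h.elim id id)
  have hnt : ∀ {x y z}, (UG E).Adj x y → (UG E).Adj x z → ¬ E y z := fun hxy hxz hyz =>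
    htf ⟨_, _, _, hxy.symm, hxz, (hadj _ _).2 (.inl hyz)⟩
  have key : ∀ {x y z x' y' z'}, y ≠ z → y' ≠ z' → (UG E).Adj x y → (UG E).Adj x z →
      (UG E).Adj x' y' → (UG E).Adj x' z' → (E x y ↔ E x' y') → (E y x ↔ E y' x') →
      (E x z ↔ E x' z') → (E z x ↔ E z' x') →
      ∃ φ : UG E ≃g UG E, (∀ a b, E (φ a) (φ b) ↔ E a b) ∧ φ x = x' ∧ φ y = y' ∧ φ z = z' := by
    intro x y z x' y' z' hyz hyz' hxy hxz hxy' hxz' h1 h2 h3 h4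
    have hinj : ∀ {x y z : V}, y ≠ z → (UG E).Adj x y → (UG E).Adj x z →
        Function.Injective ![x, y, z] := by
      intro x y z hyz hxy hxz i j hij
      have := hxy.ne
      have := hxz.ne
      fin_cases i <;> fin_cases j <;> simp_all
    obtain ⟨φ, hφ, hφf⟩ := hhom.exists_iso (hinj hyz hxy hxz) (hinj hyz' hxy' hxz') 0
      (by intro i hi; fin_cases i <;> simp_all) (by
        intro i j
        fin_cases i <;> fin_cases j <;>
          simp [hD.1, h1, h2, h3, h4, hnt hxy hxz, hnt hxz hxy, hnt hxy' hxz', hnt hxz' hxy'])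
    exact ⟨φ, hφ, hφf 0, hφf 1, hφf 2⟩
  have hl : ∀ {x y}, E x y → (UG E).Adj x y := fun h => (hadj _ _).2 (.inl h)
  have hr : ∀ {x y}, E y x → (UG E).Adj x y := fun h => (hadj _ _).2 (.inr h)
  refine ⟨hadj, hconn, hends, fun x x' => ?_, ?_, ?_, ?_⟩
  · obtain ⟨φ, hφ, hx⟩ := hhom.exists_iso (f := fun _ : Unit => x) (g := fun _ => x')
      (Function.injective_of_subsingleton _) (Function.injective_of_subsingleton _) ()
      (fun i hi => absurd rfl hi) fun _ _ => by simp [hD.1]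
    exact ⟨φ, hφ, hx ()⟩
  · intro x y z x' y' z' hxy hyz hxy' hyz'
    have hne : ∀ {x y z}, E x y → E y z → x ≠ z := by
      rintro x y _ hxy hyx rfl
      exact hD.2 _ _ hxy hyx
    obtain ⟨φ, hφ, hy, hx, hz⟩ := key (hne hxy hyz) (hne hxy' hyz') (hr hxy) (hl hyz) (hr hxy')
      (hl hyz') (iff_of_false (hD.2 _ _ hxy) (hD.2 _ _ hxy')) (iff_of_true hxy hxy')
      (iff_of_true hyz hyz') (iff_of_false (hD.2 _ _ hyz) (hD.2 _ _ hyz'))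
    exact ⟨φ, hφ, hx, hy, hz⟩
  · intro x a b x' a' b' ha hb hab ha' hb' hab'
    obtain ⟨φ, hφ, -, h⟩ := key hab hab' (hl ha) (hl hb) (hl ha') (hl hb') (iff_of_true ha ha')
      (iff_of_false (hD.2 _ _ ha) (hD.2 _ _ ha')) (iff_of_true hb hb')
      (iff_of_false (hD.2 _ _ hb) (hD.2 _ _ hb'))
    exact ⟨φ, hφ, h⟩
  · intro x a b x' a' b' ha hb hab ha' hb' hab'
    obtain ⟨φ, hφ, -, h⟩ := key hab hab' (hr ha) (hr hb) (hr ha') (hr hb')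
      (iff_of_false (hD.2 _ _ ha) (hD.2 _ _ ha')) (iff_of_true ha ha')
      (iff_of_false (hD.2 _ _ hb) (hD.2 _ _ hb')) (iff_of_true hb hb')
    exact ⟨φ, hφ, h⟩

end Homogeneous

/-- In a connected C-homogeneous triangle-free digraph with infinitely many ends,
the descendant digraph of every vertex is a tree. -/
theorem stmt_10 {V : Type u} (E : V → V → Prop) (hD : IsDigraph E)
    (hconn : (UG E).Connected) (hhom : DigraphCHom E) (htf : ¬ HasTriangle E)
    (hends : InfinitelyManyEnds (UG E)) :
    ∀ x : V, ((UG E).induce (Descendants E x)).IsTree := by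
  intro x
  have h := isHomDigraph hD hconn hhom htf hends
  rw [h.descendants_eq]
  exact h.isTree_desc x
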